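/- Assume that for every degree m ≤ n, every GC_m set possesses a maximal line (the GM conjecture up to degree n). Let X be a GC_n set with n ≥ 5 and let ℓ be a k-node line of X with 2k − n − 1 = 2 and μ(X) > 3, and suppose X_ℓ = ∅. Then there is no maximal line λ of X with λ ∩ ℓ ∩ X = ∅; that is, every maximal line of X intersects ℓ at a node of X. -/

import Mathlib

open MvPolynomial

/-- Bivariate real polynomials. -/
abbrev Poly2 : Type := MvPolynomial (Fin 2) ℝ

/-- Evaluation of a bivariate polynomial at a point of `ℝ²`. -/
noncomputable def evalPt (p : Poly2) (A : ℝ × ℝ) : ℝ :=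
  MvPolynomial.eval (fun i => if i = 0 then A.1 else A.2) p

/-- `X` is an `n`-poised set: it has `(n+2 choose 2)` nodes and the only polynomial of
total degree at most `n` vanishing on all of `X` is the zero polynomial. -/
def IsPoised (n : ℕ) (X : Finset (ℝ × ℝ)) : Prop :=
  X.card = (n + 2).choose 2 ∧
    ∀ p : Poly2, p.totalDegree ≤ n → (∀ A ∈ X, evalPt p A = 0) → p = 0

/-- `p` is an `n`-fundamental polynomial of the node `A` with respect to `X`. -/
def IsFund (n : ℕ) (X : Finset (ℝ × ℝ)) (A : ℝ × ℝ) (p : Poly2) : Prop :=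
  p.totalDegree ≤ n ∧ evalPt p A = 1 ∧ ∀ B ∈ X, B ≠ A → evalPt p B = 0

/-- `X` is a `GC_n` set: `n`-poised and each node has a fundamental polynomial which is
a product of `n` polynomials of degree 1. -/
def IsGC (n : ℕ) (X : Finset (ℝ × ℝ)) : Prop :=
  IsPoised n X ∧
    ∀ A ∈ X, ∃ p : Poly2, IsFund n X A p ∧
      ∃ f : Fin n → Poly2, (∀ i, (f i).totalDegree = 1) ∧ p = ∏ i, f i

/-- The nodes of `X` lying on the zero set of `ℓ`. -/
noncomputable def nodesOn (X : Finset (ℝ × ℝ)) (ℓ : Poly2) : Finset (ℝ × ℝ) :=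
  @Finset.filter _ (fun A => evalPt ℓ A = 0) (Classical.decPred _) X

/-- `ℓ` is a `k`-node line of `X`: it has degree exactly 1 and passes through exactly
`k` nodes of `X`. -/
def IsKNodeLine (X : Finset (ℝ × ℝ)) (ℓ : Poly2) (k : ℕ) : Prop :=
  ℓ.totalDegree = 1 ∧ (nodesOn X ℓ).card = k

/-- A maximal line of an `n`-poised set: an `(n+1)`-node line. -/
def IsMaximalLine (n : ℕ) (X : Finset (ℝ × ℝ)) (ℓ : Poly2) : Prop :=
  IsKNodeLine X ℓ (n + 1)

/-- The zero set of a polynomial, i.e. the line it determines when it has degree 1. -/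
def zeroSet (ℓ : Poly2) : Set (ℝ × ℝ) := {A | evalPt ℓ A = 0}

/-- `μ(X)`: the number of maximal lines (as subsets of the plane) of `X`. -/
noncomputable def mu (n : ℕ) (X : Finset (ℝ × ℝ)) : ℕ :=
  {L : Set (ℝ × ℝ) | ∃ ℓ : Poly2, IsMaximalLine n X ℓ ∧ L = zeroSet ℓ}.ncard

/-- The node `A` of `X` uses the line `ℓ`: `ℓ` divides a fundamental polynomial of `A`. -/
def Uses (n : ℕ) (X : Finset (ℝ × ℝ)) (ℓ : Poly2) (A : ℝ × ℝ) : Prop :=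
  ∃ p : Poly2, IsFund n X A p ∧ ℓ ∣ p

/-- `X_ℓ`: the set of nodes of `X` using the line `ℓ`. -/
noncomputable def usesSet (n : ℕ) (X : Finset (ℝ × ℝ)) (ℓ : Poly2) : Finset (ℝ × ℝ) :=
  @Finset.filter _ (Uses n X ℓ) (Classical.decPred _) X

/-- The Gasca–Maeztu conjecture for degree `m`: every `GC_m` set has a maximal line. -/
def GM (m : ℕ) : Prop :=
  ∀ Y : Finset (ℝ × ℝ), IsGC m Y → ∃ lam : Poly2, IsMaximalLine m Y lam


namespace GCL

abbrev Pt := ℝ × ℝ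

@[simp] lemma ev_mul (p q : Poly2) (A : Pt) : evalPt (p * q) A = evalPt p A * evalPt q A := by
  simp [evalPt]
@[simp] lemma ev_add (p q : Poly2) (A : Pt) : evalPt (p + q) A = evalPt p A + evalPt q A := by
  simp [evalPt]
@[simp] lemma ev_sub (p q : Poly2) (A : Pt) : evalPt (p - q) A = evalPt p A - evalPt q A := by
  simp [evalPt]
@[simp] lemma ev_zero (A : Pt) : evalPt 0 A = 0 := by simp [evalPt]
@[simp] lemma ev_one (A : Pt) : evalPt 1 A = 1 := by simp [evalPt]
@[simp] lemma ev_C (c : ℝ) (A : Pt) : evalPt (C c) A = c := by simp [evalPt]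
@[simp] lemma ev_X0 (A : Pt) : evalPt (X 0) A = A.1 := by simp [evalPt]
@[simp] lemma ev_X1 (A : Pt) : evalPt (X 1) A = A.2 := by simp [evalPt]
lemma ev_prod {ι : Type*} (s : Finset ι) (f : ι → Poly2) (A : Pt) :
    evalPt (∏ i ∈ s, f i) A = ∏ i ∈ s, evalPt (f i) A := by
  simp [evalPt]

/-- degree-one polynomials are affine forms -/
lemma linear_form {l : Poly2} (hl : l.totalDegree ≤ 1) :
    ∃ a b c : ℝ, l = C a * X 0 + C b * X 1 + C c := by
  refine ⟨coeff (Finsupp.single 0 1) l, coeff (Finsupp.single 1 1) l, coeff 0 l, ?_⟩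
  ext d
  simp only [coeff_add, coeff_C_mul, coeff_X, coeff_C]
  by_cases h0 : d = 0
  · subst h0; simp
  by_cases h1 : d = Finsupp.single 0 1
  · subst h1; simp [Finsupp.single_left_inj]; intro h; exact absurd h.symm h0
  by_cases h2 : d = Finsupp.single 1 1
  · subst h2; simp [Finsupp.single_left_inj]; intro h; exact absurd h.symm h0
  rw [if_neg (Ne.symm h1), if_neg (Ne.symm h2), if_neg (Ne.symm h0)]
  simp only [mul_zero, add_zero]
  apply coeff_eq_zero_of_totalDegree_lt
  refine lt_of_le_of_lt hl ?_
  have hs : ∑ i ∈ d.support, d i = d 0 + d 1 := by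
    rw [Finset.sum_subset (Finset.subset_univ _)]
    · simp
    · intro x _ hx; simpa using hx
  rw [hs]
  by_contra hlt
  have : (d 0 = 0 ∧ d 1 = 0) ∨ (d 0 = 1 ∧ d 1 = 0) ∨ (d 0 = 0 ∧ d 1 = 1) := by omega
  rcases this with ⟨ha, hb⟩ | ⟨ha, hb⟩ | ⟨ha, hb⟩
  · apply h0; ext i; fin_cases i <;> simp [ha, hb]
  · apply h1; ext i; fin_cases i <;> simp [ha, hb]
  · apply h2; ext i; fin_cases i <;> simp [ha, hb]

lemma linear_form' {l : Poly2} (hl : l.totalDegree = 1) :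
    ∃ a b c : ℝ, l = C a * X 0 + C b * X 1 + C c ∧ a ^ 2 + b ^ 2 ≠ 0 := by
  obtain ⟨a, b, c, h⟩ := linear_form hl.le
  refine ⟨a, b, c, h, fun h0 => ?_⟩
  have ha : a = 0 := by nlinarith [sq_nonneg a, sq_nonneg b]
  have hb : b = 0 := by nlinarith [sq_nonneg a, sq_nonneg b]
  subst ha hb
  simp at h
  rw [h] at hl
  simp at hl

/-- `p` has degree `< m` (with the zero polynomial having degree `-∞`). -/
def D (p : Poly2) (m : ℕ) : Prop := p = 0 ∨ p.totalDegree < m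

lemma D_zero {p : Poly2} (h : D p 0) : p = 0 := by
  rcases h with h | h
  · exact h
  · omega

lemma D_add {p q : Poly2} {m : ℕ} (hp : D p m) (hq : D q m) : D (p + q) m := by
  rcases hp with rfl | hp
  · simpa using hq
  rcases hq with rfl | hq
  · rw [add_zero]; exact Or.inr hp
  right
  exact lt_of_le_of_lt (totalDegree_add _ _) (max_lt hp hq)

lemma D_C_mul {p : Poly2} {m : ℕ} (c : ℝ) (hp : D p m) : D (C c * p) m := by
  rcases hp with rfl | hp
  · left; simp
  right
  refine lt_of_le_of_lt (totalDegree_mul _ _) ?_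
  simpa using hp

lemma D_sub {p q : Poly2} {m : ℕ} (hp : D p m) (hq : D q m) : D (p - q) m := by
  have := D_add hp (D_C_mul (-1) hq)
  simpa [sub_eq_add_neg] using this

lemma D_of_mul {l q : Poly2} {m : ℕ} (hl : l.totalDegree = 1) (h : D (l * q) m) : D q (m - 1) := by
  have hl0 : l ≠ 0 := by rintro rfl; simp at hl
  rcases h with h | h
  · left; simpa [hl0] using h
  by_cases hq : q = 0
  · left; exact hq
  right
  rw [totalDegree_mul_of_isDomain hl0 hq] at h
  omega

/-- key division lemma -/
lemma dvd_of_vanish {l : Poly2} (hl : l.totalDegree = 1) (S : Finset Pt)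
    (hS : ∀ P ∈ S, evalPt l P = 0) {p : Poly2} {m : ℕ} (hp : D p m) (hc : m ≤ S.card)
    (hv : ∀ P ∈ S, evalPt p P = 0) : ∃ q, p = l * q ∧ D q (m - 1) := by
  rcases hp with rfl | hp
  · exact ⟨0, by simp, Or.inl rfl⟩
  obtain ⟨a, b, c, hlab, hab⟩ := linear_form' hl
  set N := a ^ 2 + b ^ 2 with hN
  set px : ℝ := -c * a / N
  set py : ℝ := -c * b / N
  set dx : ℝ := -b / N
  set dy : ℝ := a / N
  let s : Fin 2 → Polynomial ℝ := fun i =>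
    if i = 0 then Polynomial.C px + Polynomial.C dx * Polynomial.X
    else Polynomial.C py + Polynomial.C dy * Polynomial.X
  let r : Polynomial ℝ := aeval s p
  let t : Poly2 := C (-b) * X 0 + C a * X 1
  have hdeg : r.natDegree ≤ p.totalDegree := by
    have := MvPolynomial.aeval_natDegree_le (m := p.totalDegree) (n := 1) p le_rfl s (by
      intro i
      simp only [s]
      split_ifs <;> compute_degree)
    simpa using this
  have hcong : ∀ p : Poly2, l ∣ p - Polynomial.aeval t (aeval s p) := by
    intro p
    induction p using MvPolynomial.induction_on with
    | C c => simp [MvPolynomial.algebraMap_eq]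
    | add p q hp hq =>
      have := dvd_add hp hq
      simp only [map_add]
      convert this using 1; ring
    | mul_X p i hp =>
      simp only [map_mul, aeval_X]
      have hX : l ∣ X i - Polynomial.aeval t (s i) := by
        fin_cases i
        · refine ⟨C (a / N), ?_⟩
          simp only [s, t, hlab, map_add, map_mul, Polynomial.aeval_C, Polynomial.aeval_X,
            MvPolynomial.algebraMap_eq, Fin.zero_eta, if_true]
          have e1 : (C a * C (a/N) + C b * C (b/N) : Poly2) = 1 := by
            rw [← C_mul, ← C_mul, ← C_add, ← C_1]; congr 1; field_simp; rw [hN]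
          have e2 : (C px : Poly2) = - (C c * C (a/N)) := by
            rw [← C_mul, ← C_neg]; congr 1; simp only [px]; ring
          have e3 : (C dx : Poly2) = - C (b/N) := by
            rw [← C_neg]; congr 1; simp only [dx]; ring
          have e4 : (C b * C (a/N) : Poly2) = C a * C (b/N) := by
            rw [← C_mul, ← C_mul]; congr 1; ring
          rw [e2, e3, C_neg]
          linear_combination (-X 0) * e1 - X 1 * e4
        · refine ⟨C (b / N), ?_⟩
          simp only [s, t, hlab, map_add, map_mul, Polynomial.aeval_C, Polynomial.aeval_X,
            MvPolynomial.algebraMap_eq, Fin.mk_one, one_ne_zero, if_false]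
          have e1 : (C a * C (a/N) + C b * C (b/N) : Poly2) = 1 := by
            rw [← C_mul, ← C_mul, ← C_add, ← C_1]; congr 1; field_simp; rw [hN]
          have e2 : (C py : Poly2) = - (C c * C (b/N)) := by
            rw [← C_mul, ← C_neg]; congr 1; simp only [py]; ring
          have e3 : (C dy : Poly2) = C (a/N) := rfl
          have e4 : (C b * C (a/N) : Poly2) = C a * C (b/N) := by
            rw [← C_mul, ← C_mul]; congr 1; ring
          rw [e2, e3, C_neg]
          linear_combination (-X 1) * e1 + X 0 * e4
      have h1 : l ∣ (p - Polynomial.aeval t (aeval s p)) * X i := Dvd.dvd.mul_right hp _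
      have h2 : l ∣ (Polynomial.aeval t (aeval s p)) * (X i - Polynomial.aeval t (s i)) :=
        Dvd.dvd.mul_left hX _
      convert dvd_add h1 h2 using 1; ring
  have hr : r = 0 := by
    by_contra hr0
    have hinj : Set.InjOn (fun P : Pt => -b * P.1 + a * P.2) S := by
      intro P hP Q hQ h
      have hP' := hS P hP
      have hQ' := hS Q hQ
      simp only [hlab, ev_add, ev_mul, ev_C, ev_X0, ev_X1] at hP' hQ' h
      have h1 : N * (P.1 - Q.1) = 0 := by
        rw [hN]; linear_combination a * (hP' - hQ') - b * h
      have h2 : N * (P.2 - Q.2) = 0 := by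
        rw [hN]; linear_combination b * (hP' - hQ') + a * h
      have h1' := (mul_eq_zero.mp h1).resolve_left hab
      have h2' := (mul_eq_zero.mp h2).resolve_left hab
      exact Prod.ext (by linarith) (by linarith)
    classical
    have hsub : (S.image (fun P : Pt => -b * P.1 + a * P.2)) ⊆ r.roots.toFinset := by
      intro y hy
      obtain ⟨P, hP, rfl⟩ := Finset.mem_image.mp hy
      rw [Multiset.mem_toFinset, Polynomial.mem_roots hr0, Polynomial.IsRoot.def]
      have hP' := hS P hP
      obtain ⟨q, hq⟩ := hcong p
      have h3 := congrArg (fun x => evalPt x P) hq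
      simp only [ev_sub, ev_mul, hP', hv P hP, zero_mul, zero_sub, neg_eq_zero] at h3
      rw [← h3]
      simp only [evalPt, t]
      rw [← MvPolynomial.coe_aeval_eq_eval, RingHom.coe_coe, ← Polynomial.aeval_algHom_apply]
      simp [r, Polynomial.aeval_def, Polynomial.eval₂_eq_eval_map]
    have hcard := Finset.card_le_card hsub
    rw [Finset.card_image_of_injOn hinj] at hcard
    have h4 : r.roots.toFinset.card ≤ r.natDegree :=
      (Multiset.toFinset_card_le _).trans (Polynomial.card_roots' r)
    omega
  obtain ⟨q, hq⟩ := hcong p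
  have hq' : p = l * q := by
    rw [← hq]; change p = p - Polynomial.aeval t r; rw [hr]; simp
  refine ⟨q, hq', D_of_mul hl ?_⟩
  rw [← hq']; right; exact hp


open Classical in
/-- nodes of `X` on `L` -/
noncomputable def on (X : Finset Pt) (L : Set Pt) : Finset Pt := X.filter (fun A => A ∈ L)

open Classical in
/-- nodes of `X` off `L` -/
noncomputable def rm (X : Finset Pt) (L : Set Pt) : Finset Pt := X.filter (fun A => A ∉ L)

/-- `L` is a line -/
def Ln (L : Set Pt) : Prop := ∃ l : Poly2, l.totalDegree = 1 ∧ L = zeroSet l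

/-- `L` is a maximal line -/
def Mx (n : ℕ) (X : Finset Pt) (L : Set Pt) : Prop := Ln L ∧ (on X L).card = n + 1

@[simp] lemma mem_on {X : Finset Pt} {L : Set Pt} {A : Pt} : A ∈ on X L ↔ A ∈ X ∧ A ∈ L := by
  simp [on]
@[simp] lemma mem_rm {X : Finset Pt} {L : Set Pt} {A : Pt} : A ∈ rm X L ↔ A ∈ X ∧ A ∉ L := by
  simp [rm]
lemma mem_zs {l : Poly2} {A : Pt} : A ∈ zeroSet l ↔ evalPt l A = 0 := Iff.rfl

lemma on_add_rm (X : Finset Pt) (L : Set Pt) : (on X L).card + (rm X L).card = X.card := by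
  classical
  have := Finset.card_filter_add_card_filter_not (s := X) (fun A => A ∈ L)
  simp only [on, rm]
  convert this

lemma D_one {q : Poly2} (h : D q 1) : ∃ c : ℝ, q = C c := by
  rcases h with rfl | h
  · exact ⟨0, by simp⟩
  · exact ⟨coeff 0 q, totalDegree_eq_zero_iff_eq_C.mp (by omega)⟩

lemma D_le {p : Poly2} {m : ℕ} (h : p.totalDegree ≤ m) : D p (m + 1) := Or.inr (by omega)

lemma le_of_D {p : Poly2} {m : ℕ} (h : D p (m + 1)) : p.totalDegree ≤ m := by
  rcases h with rfl | h
  · simp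
  · omega

lemma D_mono {p : Poly2} {m k : ℕ} (h : D p m) (hk : m ≤ k) : D p k := by
  rcases h with h | h
  · exact Or.inl h
  · exact Or.inr (by omega)

lemma D_mul1 {l q : Poly2} {m : ℕ} (hl : l.totalDegree = 1) (hq : D q m) : D (l * q) (m + 1) := by
  rcases hq with rfl | h
  · left; simp
  · right
    have := totalDegree_mul l q
    omega

/-- two degree-one polynomials sharing two zeros are proportional -/
lemma prop_of_two {l l' : Poly2} (hl : l.totalDegree = 1) (hl' : l'.totalDegree = 1) {P Q : Pt}
    (hPQ : P ≠ Q) (h1 : evalPt l P = 0) (h2 : evalPt l Q = 0) (h3 : evalPt l' P = 0)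
    (h4 : evalPt l' Q = 0) : ∃ c : ℝ, c ≠ 0 ∧ l' = C c * l := by
  classical
  obtain ⟨q, hq, hD⟩ := dvd_of_vanish hl {P, Q} (by simp [h1, h2]) (D_le hl'.le) (by
    rw [Finset.card_pair hPQ]) (by simp [h3, h4])
  obtain ⟨c, rfl⟩ := D_one hD
  refine ⟨c, ?_, by rw [hq]; ring⟩
  rintro rfl
  simp at hq
  subst hq
  simp at hl'

lemma zs_C_mul {l : Poly2} {c : ℝ} (hc : c ≠ 0) : zeroSet (C c * l) = zeroSet l := by
  ext A; simp [mem_zs, hc]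

lemma line_eq {L M : Set Pt} (hL : Ln L) (hM : Ln M) {P Q : Pt} (hPQ : P ≠ Q) (h1 : P ∈ L)
    (h2 : Q ∈ L) (h3 : P ∈ M) (h4 : Q ∈ M) : L = M := by
  obtain ⟨l, hl, rfl⟩ := hL
  obtain ⟨m, hm, rfl⟩ := hM
  obtain ⟨c, hc, rfl⟩ := prop_of_two hl hm hPQ h1 h2 h3 h4
  rw [zs_C_mul hc]

lemma pt_eq {L M : Set Pt} (hL : Ln L) (hM : Ln M) (hLM : L ≠ M) {P Q : Pt} (h1 : P ∈ L)
    (h2 : Q ∈ L) (h3 : P ∈ M) (h4 : Q ∈ M) : P = Q := by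
  by_contra h
  exact hLM (line_eq hL hM h h1 h2 h3 h4)

lemma same_zs {l l' : Poly2} (hl : l.totalDegree = 1) (hl' : l'.totalDegree = 1)
    (h : zeroSet l = zeroSet l') : ∃ c : ℝ, c ≠ 0 ∧ l' = C c * l := by
  obtain ⟨a, b, c, hlab, hab⟩ := linear_form' hl
  let P : Pt := (-c * a / (a^2+b^2), -c * b / (a^2+b^2))
  let Q : Pt := (-c * a / (a^2+b^2) - b, -c * b / (a^2+b^2) + a)
  have hP : P ∈ zeroSet l := by
    simp only [mem_zs, hlab, ev_add, ev_mul, ev_C, ev_X0, ev_X1, P]; field_simp; ring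
  have hQ : Q ∈ zeroSet l := by
    simp only [mem_zs, hlab, ev_add, ev_mul, ev_C, ev_X0, ev_X1, Q]; field_simp; ring
  have hPQ : P ≠ Q := by
    intro h
    simp only [P, Q, Prod.mk.injEq] at h
    apply hab
    have h1 : b = 0 := by linarith [h.1]
    have h2 : a = 0 := by linarith [h.2]
    simp [h1, h2]
  exact prop_of_two hl hl' hPQ hP hQ (mem_zs.mp (h ▸ hP)) (mem_zs.mp (h ▸ hQ))

lemma exists_line {P Q : Pt} (h : P ≠ Q) : ∃ L, Ln L ∧ P ∈ L ∧ Q ∈ L := by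
  let l : Poly2 := C (P.2 - Q.2) * X 0 + C (Q.1 - P.1) * X 1 + C (P.1 * Q.2 - Q.1 * P.2)
  have hle : l.totalDegree ≤ 1 := by
    refine (totalDegree_add _ _).trans (max_le ((totalDegree_add _ _).trans (max_le ?_ ?_)) ?_)
    · exact (totalDegree_mul _ _).trans (by rw [totalDegree_C, totalDegree_X])
    · exact (totalDegree_mul _ _).trans (by rw [totalDegree_C, totalDegree_X])
    · rw [totalDegree_C]; exact Nat.zero_le _
  refine ⟨zeroSet l, ⟨l, ?_, rfl⟩, ?_, ?_⟩
  · by_contra hne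
    have h0 : l.totalDegree = 0 := by omega
    rw [totalDegree_eq_zero_iff_eq_C] at h0
    have e : ∀ A : Pt, evalPt l A = coeff 0 l := by intro A; rw [h0]; simp
    have e1 := e (0, 0)
    have e2 := e (1, 0)
    have e3 := e (0, 1)
    simp only [l, ev_add, ev_mul, ev_C, ev_X0, ev_X1] at e1 e2 e3
    apply h
    exact Prod.ext (by linarith) (by linarith)
  · simp only [mem_zs, l, ev_add, ev_mul, ev_C, ev_X0, ev_X1]; ring
  · simp only [mem_zs, l, ev_add, ev_mul, ev_C, ev_X0, ev_X1]; ring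

/-- divisibility in set form -/
lemma dvd_on {l p : Poly2} (hl : l.totalDegree = 1) {S : Finset Pt} {m : ℕ} (hp : D p m)
    (hc : m ≤ (on S (zeroSet l)).card) (hv : ∀ P ∈ S, P ∈ zeroSet l → evalPt p P = 0) :
    ∃ q, p = l * q ∧ D q (m - 1) :=
  dvd_of_vanish hl (on S (zeroSet l)) (fun P hP => (mem_on.mp hP).2) hp hc
    (fun P hP => hv P (mem_on.mp hP).1 (mem_on.mp hP).2)

lemma gc_unique {n : ℕ} {X : Finset Pt} (h : IsGC n X) {p : Poly2} (hp : D p (n + 1))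
    (hv : ∀ A ∈ X, evalPt p A = 0) : p = 0 := h.1.2 p (le_of_D hp) hv

lemma D_prod {n : ℕ} {f : Fin n → Poly2} (hf : ∀ i, (f i).totalDegree = 1) :
    D (∏ i, f i) (n + 1) := by
  apply D_le
  refine (totalDegree_finsetProd _ _).trans ?_
  simp [hf]

lemma gc_fund {n : ℕ} {X : Finset Pt} (h : IsGC n X) {A : Pt} (hA : A ∈ X) :
    ∃ f : Fin n → Poly2, (∀ i, (f i).totalDegree = 1) ∧ evalPt (∏ i, f i) A ≠ 0 ∧
      ∀ B ∈ X, B ≠ A → evalPt (∏ i, f i) B = 0 := by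
  obtain ⟨p, ⟨h1, h2, h3⟩, f, hf, rfl⟩ := h.2 A hA
  exact ⟨f, hf, by rw [h2]; exact one_ne_zero, h3⟩

lemma gc_fund' {n : ℕ} {X : Finset Pt} (h : IsGC n X) {A : Pt} (hA : A ∈ X) :
    ∃ p : Poly2, D p (n + 1) ∧ evalPt p A ≠ 0 ∧ ∀ B ∈ X, B ≠ A → evalPt p B = 0 := by
  obtain ⟨f, hf, h1, h2⟩ := gc_fund h hA
  exact ⟨_, D_prod hf, h1, h2⟩

lemma deg_C_mul {c : ℝ} (hc : c ≠ 0) (p : Poly2) : (C c * p).totalDegree = p.totalDegree := by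
  by_cases hp : p = 0
  · subst hp; simp
  rw [totalDegree_mul_of_isDomain (by simpa using hc) hp]; simp

lemma gc_mk {n : ℕ} {X : Finset Pt} (h : IsPoised n X)
    (hf : ∀ A ∈ X, ∃ f : Fin n → Poly2, (∀ i, (f i).totalDegree = 1) ∧ evalPt (∏ i, f i) A ≠ 0 ∧
      ∀ B ∈ X, B ≠ A → evalPt (∏ i, f i) B = 0) : IsGC n X := by
  refine ⟨h, fun A hA => ?_⟩
  obtain ⟨f, h1, h2, h3⟩ := hf A hA
  cases n with
  | zero =>
    exact ⟨_, ⟨le_of_D (D_prod h1), by simp, h3⟩, f, h1, rfl⟩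
  | succ n =>
    set c := evalPt (∏ i, f i) A with hc
    let g : Fin (n+1) → Poly2 := Fin.cons (C c⁻¹ * f 0) (fun i => f i.succ)
    have hg : ∏ i, g i = C c⁻¹ * ∏ i, f i := by
      rw [Fin.prod_univ_succ, Fin.prod_univ_succ]; simp [g, mul_assoc]
    have hg1 : ∀ i, (g i).totalDegree = 1 := by
      intro i
      refine Fin.cases ?_ (fun j => ?_) i
      · simp only [g, Fin.cons_zero]; rw [deg_C_mul (inv_ne_zero h2)]; exact h1 0
      · simp [g, h1]
    refine ⟨_, ⟨le_of_D (D_prod hg1), ?_, ?_⟩, g, hg1, rfl⟩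
    · rw [hg, ev_mul, ev_C, ← hc]; exact inv_mul_cancel₀ h2
    · intro B hB hBA
      rw [hg, ev_mul, h3 B hB hBA, mul_zero]

lemma card_le {n : ℕ} {X : Finset Pt} (h : IsGC n X) {L : Set Pt} (hL : Ln L) :
    (on X L).card ≤ n + 1 := by
  classical
  by_contra hc
  push Not at hc
  obtain ⟨l, hl, rfl⟩ := hL
  obtain ⟨A, hA⟩ := Finset.card_pos.mp (show 0 < (on X (zeroSet l)).card by omega)
  obtain ⟨p, hp, h1, h2⟩ := gc_fund' h (mem_on.mp hA).1
  obtain ⟨q, rfl, -⟩ := dvd_of_vanish hl ((on X (zeroSet l)).erase A)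
    (fun P hP => (mem_on.mp (Finset.mem_of_mem_erase hP)).2) hp
    (by rw [Finset.card_erase_of_mem hA]; omega)
    (fun P hP => h2 P (mem_on.mp (Finset.mem_of_mem_erase hP)).1 (Finset.ne_of_mem_erase hP))
  apply h1
  rw [ev_mul, mem_zs.mp (mem_on.mp hA).2, zero_mul]

lemma rm_gc {n : ℕ} {X : Finset Pt} (h : IsGC (n + 1) X) {L : Set Pt} (hL : Mx (n + 1) X L) :
    IsGC n (rm X L) := by
  obtain ⟨⟨l, hl, rfl⟩, hc⟩ := hL
  have hl0 : l ≠ 0 := by rintro rfl; simp at hl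
  have hsum := on_add_rm X (zeroSet l)
  have hX := h.1.1
  refine gc_mk ⟨?_, ?_⟩ ?_
  · have : (n + 1 + 2).choose 2 = (n + 2) + (n + 2).choose 2 := by
      rw [show n + 1 + 2 = (n+2) + 1 by ring, Nat.choose_succ_succ]; simp
    omega
  · intro p hp hv
    have : l * p = 0 := by
      apply gc_unique h (D_mul1 hl (D_le hp))
      intro A hA
      rw [ev_mul]
      by_cases hAl : A ∈ zeroSet l
      · rw [mem_zs.mp hAl, zero_mul]
      · rw [hv A (mem_rm.mpr ⟨hA, hAl⟩), mul_zero]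
    simpa [hl0] using this
  · intro A hA
    obtain ⟨hAX, hAl⟩ := mem_rm.mp hA
    obtain ⟨f, hf, h1, h2⟩ := gc_fund h hAX
    have hz : ∀ P ∈ on X (zeroSet l), ∃ i, evalPt (f i) P = 0 := by
      intro P hP
      have h3 := h2 P (mem_on.mp hP).1 (by rintro rfl; exact hAl (mem_on.mp hP).2)
      rw [ev_prod, Finset.prod_eq_zero_iff] at h3
      obtain ⟨i, -, hi⟩ := h3
      exact ⟨i, hi⟩
    choose! g hg using hz
    obtain ⟨P, hP, Q, hQ, hPQ, he⟩ := Finset.exists_ne_map_eq_of_card_lt_of_maps_to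
      (s := on X (zeroSet l)) (t := Finset.univ) (f := g) (by simp; omega) (by simp)
    obtain ⟨c, hc0, hfi⟩ := prop_of_two hl (hf (g P)) hPQ (mem_on.mp hP).2 (mem_on.mp hQ).2
      (hg P hP) (he ▸ hg Q hQ)
    refine ⟨fun j => f ((g P).succAbove j), fun j => hf _, ?_, ?_⟩
    · intro h0
      apply h1
      rw [Fin.prod_univ_succAbove _ (g P), ev_mul, h0, mul_zero]
    · intro B hB hBA
      obtain ⟨hBX, hBl⟩ := mem_rm.mp hB
      have h3 := h2 B hBX hBA
      rw [Fin.prod_univ_succAbove _ (g P), ev_mul, hfi, ev_mul, ev_C, mul_eq_zero] at h3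
      rcases h3 with h3 | h3
      · exact absurd h3 (mul_ne_zero hc0 hBl)
      · exact h3

lemma rm_comm (X : Finset Pt) (L M : Set Pt) : rm (rm X L) M = rm (rm X M) L := by
  ext A; simp only [mem_rm]; tauto

lemma on_rm_sub (X : Finset Pt) (L M : Set Pt) : on (rm X L) M ⊆ on X M := by
  intro A; simp only [mem_on, mem_rm]; tauto

/-- counting nodes of `M` when removing `L` -/
lemma card_on_rm {X : Finset Pt} {L M : Set Pt} (hL : Ln L) (hM : Ln M) (hne : L ≠ M) :
    ((∃ P ∈ X, P ∈ L ∧ P ∈ M) ∧ (on X M).card = (on (rm X L) M).card + 1) ∨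
    ((¬ ∃ P ∈ X, P ∈ L ∧ P ∈ M) ∧ on X M = on (rm X L) M) := by
  classical
  by_cases h : ∃ P ∈ X, P ∈ L ∧ P ∈ M
  · left
    refine ⟨h, ?_⟩
    obtain ⟨P, hP, hPL, hPM⟩ := h
    have : on X M = insert P (on (rm X L) M) := by
      ext A
      simp only [mem_on, mem_rm, Finset.mem_insert]
      constructor
      · rintro ⟨hA, hAM⟩
        by_cases hAL : A ∈ L
        · left; exact pt_eq hL hM hne hAL hPL hAM hPM
        · right; exact ⟨⟨hA, hAL⟩, hAM⟩
      · rintro (rfl | ⟨⟨hA, -⟩, hAM⟩)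
        · exact ⟨hP, hPM⟩
        · exact ⟨hA, hAM⟩
    rw [this, Finset.card_insert_of_notMem]
    simp [hPL]
  · right
    refine ⟨h, ?_⟩
    ext A
    simp only [mem_on, mem_rm]
    constructor
    · rintro ⟨hA, hAM⟩
      exact ⟨⟨hA, fun hAL => h ⟨A, hA, hAL, hAM⟩⟩, hAM⟩
    · rintro ⟨⟨hA, -⟩, hAM⟩
      exact ⟨hA, hAM⟩

lemma mx_rm_meet {n : ℕ} {X : Finset Pt} (h : IsGC (n + 1) X) {L M : Set Pt}
    (hL : Mx (n + 1) X L) (hM : Mx (n + 1) X M) (hne : L ≠ M) :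
    Mx n (rm X L) M ∧ ∃ P ∈ X, P ∈ L ∧ P ∈ M := by
  have hle := card_le (rm_gc h hL) hM.1
  have hc := hM.2
  rcases card_on_rm (X := X) hL.1 hM.1 hne with ⟨h1, h2⟩ | ⟨h1, h2⟩
  · exact ⟨⟨hM.1, by omega⟩, h1⟩
  · rw [h2] at hc; omega

lemma mx_rm {n : ℕ} {X : Finset Pt} (h : IsGC (n + 1) X) {L M : Set Pt}
    (hL : Mx (n + 1) X L) (hM : Mx (n + 1) X M) (hne : L ≠ M) : Mx n (rm X L) M :=
  (mx_rm_meet h hL hM hne).1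

lemma mx_meet {n : ℕ} {X : Finset Pt} (h : IsGC (n + 1) X) {L M : Set Pt}
    (hL : Mx (n + 1) X L) (hM : Mx (n + 1) X M) (hne : L ≠ M) : ∃ P ∈ X, P ∈ L ∧ P ∈ M :=
  (mx_rm_meet h hL hM hne).2

lemma rm_ne {n : ℕ} {X : Finset Pt} {L M : Set Pt} (hM : Mx n (rm X L) M) : L ≠ M := by
  rintro rfl
  have : on (rm X L) L = ∅ := by ext A; simp
  have h2 := hM.2
  rw [this] at h2
  simp at h2

lemma mx_up {n : ℕ} {X : Finset Pt} (h : IsGC (n + 1) X) {L M : Set Pt}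
    (hL : Ln L) (hM : Mx n (rm X L) M) (hP : ∃ P ∈ X, P ∈ L ∧ P ∈ M) : Mx (n + 1) X M := by
  have hc := hM.2
  rcases card_on_rm (X := X) hL hM.1 (rm_ne hM) with ⟨h1, h2⟩ | ⟨h1, h2⟩
  · exact ⟨hM.1, by omega⟩
  · exact absurd hP h1

/-- max in `rm X L` but not in `X` means missing `L` -/
lemma mx_miss {n : ℕ} {X : Finset Pt} (h : IsGC (n + 1) X) {L M : Set Pt}
    (hL : Ln L) (hM : Mx n (rm X L) M) (hP : ¬ Mx (n + 1) X M) : ∀ P ∈ X, P ∈ L → P ∉ M := by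
  intro P hX hPL hPM
  exact hP (mx_up h hL hM ⟨P, hX, hPL, hPM⟩)

lemma gc0 {X : Finset Pt} (h : IsGC 0 X) : ∃ A, X = {A} := by
  have := h.1.1
  simp at this
  exact Finset.card_eq_one.mp this

lemma no_three {n : ℕ} {X : Finset Pt} (h : IsGC (n + 1) X) {L M K : Set Pt}
    (hL : Mx (n + 1) X L) (hM : Mx (n + 1) X M) (hK : Mx (n + 1) X K) (h1 : L ≠ M) (h2 : L ≠ K)
    (h3 : M ≠ K) {P : Pt} (hPL : P ∈ L) (hPM : P ∈ M) (hPK : P ∈ K) : False := by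
  have hM' := mx_rm h hL hM h1
  have hK' := mx_rm h hL hK h2
  have hg := rm_gc h hL
  cases n with
  | zero =>
    obtain ⟨A, hA⟩ := gc0 hg
    obtain ⟨Q, hQ⟩ := Finset.card_pos.mp (show 0 < (on (rm X L) M).card by rw [hM'.2]; omega)
    obtain ⟨R, hR⟩ := Finset.card_pos.mp (show 0 < (on (rm X L) K).card by rw [hK'.2]; omega)
    have hQ' := mem_on.mp hQ
    have hR' := mem_on.mp hR
    have eQ : Q = A := by have := hQ'.1; rw [hA] at this; simpa using this
    have eR : R = A := by have := hR'.1; rw [hA] at this; simpa using this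
    subst eQ
    subst eR
    have := pt_eq hM.1 hK.1 h3 hPM hQ'.2 hPK hR'.2
    subst this
    exact (mem_rm.mp hQ'.1).2 hPL
  | succ n =>
    obtain ⟨Q, hQ, hQM, hQK⟩ := mx_meet hg hM' hK' h3
    have := pt_eq hM.1 hK.1 h3 hPM hQM hPK hQK
    subst this
    exact (mem_rm.mp hQ).2 hPL

/-- some node uses the line `L` -/
def NE (n : ℕ) (X : Finset Pt) (L : Set Pt) : Prop :=
  ∃ l q : Poly2, l.totalDegree = 1 ∧ L = zeroSet l ∧ D q n ∧
    ∃ A ∈ X, evalPt (l * q) A ≠ 0 ∧ ∀ B ∈ X, B ≠ A → evalPt (l * q) B = 0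

lemma ne_lift {n : ℕ} {X : Finset Pt} {L M : Set Pt}
    (hL : Ln L) (h : NE n (rm X L) M) : NE (n + 1) X M := by
  obtain ⟨l, hl, rfl⟩ := hL
  obtain ⟨m, q, hm, hM, hq, A, hA, h1, h2⟩ := h
  refine ⟨m, l * q, hm, hM, D_mul1 hl hq, A, (mem_rm.mp hA).1, ?_, ?_⟩
  · rw [show m * (l * q) = l * (m * q) by ring, ev_mul]
    exact mul_ne_zero (mem_rm.mp hA).2 h1
  · intro B hB hBA
    rw [show m * (l * q) = l * (m * q) by ring, ev_mul]
    by_cases hBl : B ∈ zeroSet l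
    · rw [mem_zs.mp hBl, zero_mul]
    · rw [h2 B (mem_rm.mpr ⟨hB, hBl⟩) hBA, mul_zero]

lemma ne_of_mx {n : ℕ} {X : Finset Pt} (h : IsGC (n + 1) X) {L : Set Pt} (hL : Mx (n + 1) X L) :
    NE (n + 1) X L := by
  have hg := rm_gc h hL
  obtain ⟨l, hl, rfl⟩ := hL.1
  have hpos : 0 < (rm X (zeroSet l)).card := by
    rw [hg.1.1]; exact Nat.choose_pos (by omega)
  obtain ⟨A, hA⟩ := Finset.card_pos.mp hpos
  obtain ⟨q, hq, h1, h2⟩ := gc_fund' hg hA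
  refine ⟨l, q, hl, rfl, hq, A, (mem_rm.mp hA).1, ?_, ?_⟩
  · rw [ev_mul]
    exact mul_ne_zero (mem_rm.mp hA).2 h1
  · intro B hB hBA
    rw [ev_mul]
    by_cases hBl : B ∈ zeroSet l
    · rw [mem_zs.mp hBl, zero_mul]
    · rw [h2 B (mem_rm.mpr ⟨hB, hBl⟩) hBA, mul_zero]

lemma uses_of_ne {n : ℕ} {X : Finset Pt} {l : Poly2} (hl : l.totalDegree = 1)
    (h : NE n X (zeroSet l)) : (usesSet n X l).Nonempty := by
  obtain ⟨m, q, hm, hM, hq, A, hA, h1, h2⟩ := h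
  obtain ⟨c, hc, rfl⟩ := same_zs hm hl hM.symm
  refine ⟨A, ?_⟩
  simp only [usesSet, Finset.mem_filter]
  refine ⟨hA, C (evalPt (m * q) A)⁻¹ * (m * q), ⟨?_, ?_, ?_⟩, ?_⟩
  · exact le_of_D (D_C_mul _ (D_mul1 hm hq))
  · rw [ev_mul, ev_C]; exact inv_mul_cancel₀ h1
  · intro B hB hBA
    rw [ev_mul, h2 B hB hBA, mul_zero]
  · refine ⟨C c⁻¹ * C (evalPt (m * q) A)⁻¹ * q, ?_⟩
    have : (C c * C c⁻¹ : Poly2) = 1 := by rw [← C_mul, mul_inv_cancel₀ hc, C_1]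
    linear_combination (-(C (evalPt (m * q) A)⁻¹ * m * q)) * this

lemma finite_mx {n : ℕ} (X : Finset Pt) : {L | Mx (n + 1) X L}.Finite := by
  classical
  have hf : ((X.powerset : Finset (Finset Pt)) : Set (Finset Pt)).Finite := Finset.finite_toSet _
  refine Set.Finite.of_finite_image (f := fun L => on X L) (hf.subset ?_) ?_
  · rintro _ ⟨L, -, rfl⟩
    simp only [Finset.coe_powerset, Set.mem_preimage, Set.mem_powerset_iff, Finset.coe_subset]
    intro A hA
    exact (mem_on.mp hA).1
  · intro L hL M hM he
    have h2 := hL.2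
    obtain ⟨P, hP, Q, hQ, hPQ⟩ := Finset.one_lt_card.mp (show 1 < (on X L).card by omega)
    have he' : on X L = on X M := he
    have hP' := he' ▸ hP
    have hQ' := he' ▸ hQ
    exact line_eq hL.1 hM.1 hPQ (mem_on.mp hP).2 (mem_on.mp hQ).2 (mem_on.mp hP').2 (mem_on.mp hQ').2

open Classical in
/-- finset of maximal lines -/
noncomputable def ML (n : ℕ) (X : Finset Pt) : Finset (Set Pt) :=
  if h : {L | Mx n X L}.Finite then h.toFinset else ∅

@[simp] lemma mem_ML {n : ℕ} {X : Finset Pt} {L : Set Pt} : L ∈ ML (n + 1) X ↔ Mx (n + 1) X L := by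
  rw [ML, dif_pos (finite_mx X)]; simp

lemma mu_eq {n : ℕ} {X : Finset Pt} : mu (n + 1) X = (ML (n + 1) X).card := by
  rw [mu, ← Set.ncard_coe_finset]
  congr 1
  ext L
  simp only [Set.mem_ofPred_eq, Finset.mem_coe, mem_ML]
  have key : ∀ l : Poly2, nodesOn X l = on X (zeroSet l) := by
    intro l; ext A; simp [nodesOn, on, mem_zs]
  constructor
  · rintro ⟨l, ⟨hl, hc⟩, rfl⟩
    exact ⟨⟨l, hl, rfl⟩, by rw [← key]; exact hc⟩
  · rintro ⟨⟨l, hl, rfl⟩, hc⟩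
    exact ⟨l, ⟨hl, by rw [key]; exact hc⟩, rfl⟩

lemma mu_le {n : ℕ} {X : Finset Pt} (h : IsGC (n + 1) X) : (ML (n + 1) X).card ≤ n + 3 := by
  classical
  by_cases h0 : ML (n + 1) X = ∅
  · simp [h0]
  obtain ⟨L, hL⟩ := Finset.nonempty_iff_ne_empty.mpr h0
  have hL' := mem_ML.mp hL
  have hz : ∀ M ∈ (ML (n + 1) X).erase L, ∃ P, P ∈ on X L ∧ P ∈ M := by
    intro M hM
    obtain ⟨P, hP, h1, h2⟩ := mx_meet h hL' (mem_ML.mp (Finset.mem_of_mem_erase hM))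
      (Finset.ne_of_mem_erase hM).symm
    exact ⟨P, mem_on.mpr ⟨hP, h1⟩, h2⟩
  choose! g hg using hz
  have := Finset.card_le_card_of_injOn g (fun M hM => (hg M hM).1) (by
    intro M hM M' hM' he
    by_contra hne
    have a := hg M hM
    have b := hg M' hM'
    rw [← he] at b
    exact no_three h hL' (mem_ML.mp (Finset.mem_of_mem_erase hM))
      (mem_ML.mp (Finset.mem_of_mem_erase hM')) (Finset.ne_of_mem_erase hM).symm
      (Finset.ne_of_mem_erase hM').symm hne (mem_on.mp a.1).2 a.2 b.2)
  rw [Finset.card_erase_of_mem hL, hL'.2] at this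
  omega


lemma claim00 {n : ℕ} {X : Finset Pt} {L : Set Pt} (hL : Mx (n + 1) X L)
    {A : Pt} (hA : A ∈ X) (hAL : A ∈ L) {g q : Poly2} (hq : D q (n + 1))
    (h1 : evalPt (g * q) A ≠ 0) (h2 : ∀ B ∈ X, B ∈ L → B ≠ A → evalPt (g * q) B = 0) :
    ∃ t ∈ X, t ∈ L ∧ t ≠ A ∧ evalPt g t = 0 := by
  classical
  by_contra hcon
  push Not at hcon
  obtain ⟨⟨l, hl, rfl⟩, hc⟩ := hL
  obtain ⟨r, rfl, -⟩ := dvd_of_vanish hl ((on X (zeroSet l)).erase A)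
    (fun P hP => (mem_on.mp (Finset.mem_of_mem_erase hP)).2) hq
    (by rw [Finset.card_erase_of_mem (mem_on.mpr ⟨hA, hAL⟩)]; omega)
    (fun P hP => by
      have hP1 := mem_on.mp (Finset.mem_of_mem_erase hP)
      have hP2 := Finset.ne_of_mem_erase hP
      have h3 := h2 P hP1.1 hP1.2 hP2
      rw [ev_mul] at h3
      exact (mul_eq_zero.mp h3).resolve_left (hcon P hP1.1 hP1.2 hP2))
  apply h1
  rw [ev_mul, ev_mul, mem_zs.mp hAL]; ring

lemma claim0 {n : ℕ} {X : Finset Pt} {L : Set Pt} (hL : Mx (n + 1) X L)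
    {A : Pt} (hA : A ∈ X) (hAL : A ∈ L) {g q : Poly2} (hq : D q (n + 1))
    (h1 : evalPt (g * q) A ≠ 0) (h2 : ∀ B ∈ X, B ≠ A → evalPt (g * q) B = 0) :
    ∃ t ∈ X, t ∈ L ∧ t ≠ A ∧ evalPt g t = 0 :=
  claim00 hL hA hAL hq h1 (fun B hB _ h => h2 B hB h)

/-- the data attached to a node on the maximal line -/
structure Dat (n : ℕ) (X : Finset Pt) (L : Set Pt) (P A : Pt) (g q : Poly2) (t : Pt) : Prop where
  hg : g.totalDegree = 1
  hq : D q (n + 1)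
  hA : evalPt g A ≠ 0
  hqA : evalPt q A ≠ 0
  hv : ∀ B ∈ X, B ≠ A → evalPt g B ≠ 0 → evalPt q B = 0
  hP : evalPt g P = 0
  hqP : evalPt q P ≠ 0
  tX : t ∈ X
  tL : t ∈ L
  tA : t ≠ A
  gt : evalPt g t = 0

lemma dat_exists {n : ℕ} {X : Finset Pt} {L : Set Pt} (h : IsGC (n + 1) X) (hL : Mx (n + 1) X L)
    {m : Set Pt} (hm : Mx n (rm X L) m) (hmiss : ∀ P ∈ X, P ∈ L → P ∉ m)
    {P : Pt} (hP : P ∈ rm X L) (hPm : P ∈ m) {A : Pt} (hA : A ∈ X) (hAL : A ∈ L) :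
    ∃ g q t, Dat n X L P A g q t := by
  obtain ⟨hPX, hPL⟩ := mem_rm.mp hP
  have hPA : P ≠ A := by rintro rfl; exact hPL hAL
  obtain ⟨f, hf, h1, h2⟩ := gc_fund h hA
  have hp0 := h2 P hPX hPA
  rw [ev_prod, Finset.prod_eq_zero_iff] at hp0
  obtain ⟨i, -, hi⟩ := hp0
  rw [Fin.prod_univ_succAbove _ i] at h1 h2
  set g := f i
  set q := ∏ j, f (i.succAbove j)
  have hq : D q (n + 1) := D_prod (fun j => hf _)
  obtain ⟨⟨l, hl, rfl⟩, hc⟩ := hm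
  have hqP : evalPt q P ≠ 0 := by
    intro hqP
    by_cases hgm : ∃ c : ℝ, c ≠ 0 ∧ g = C c * l
    · obtain ⟨c, hc0, hg⟩ := hgm
      obtain ⟨t, ht, htL, -, h0⟩ := claim0 hL hA hAL hq h1 h2
      apply hmiss t ht htL
      rw [hg, ev_mul, ev_C] at h0
      exact (mul_eq_zero.mp h0).resolve_left hc0
    · obtain ⟨r, hr, hD⟩ := dvd_on hl (S := rm X L) hq hc.ge (by
        intro B hB hBm
        by_cases hBP : B = P
        · rw [hBP, hqP]
        have h3 := h2 B (mem_rm.mp hB).1 (by rintro rfl; exact (mem_rm.mp hB).2 hAL)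
        rw [ev_mul] at h3
        refine (mul_eq_zero.mp h3).resolve_left fun h0 => hgm ?_
        exact prop_of_two hl (hf i) hBP hBm hPm h0 hi)
      have e : g * q = l * (g * r) := by rw [hr]; ring
      rw [e] at h1 h2
      obtain ⟨t, ht, htL, -, h0⟩ := claim0 hL hA hAL (D_mul1 (hf i) hD) h1 h2
      exact hmiss t ht htL h0
  obtain ⟨t, ht, htL, htA, h0⟩ := claim0 hL hA hAL hq h1 h2
  rw [ev_mul] at h1
  refine ⟨g, q, t, hf i, hq, left_ne_zero_of_mul h1, right_ne_zero_of_mul h1, ?_, hi, hqP, ht, htL,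
    htA, h0⟩
  intro B hB hBA hgB
  have h3 := h2 B hB hBA
  rw [ev_mul] at h3
  exact (mul_eq_zero.mp h3).resolve_left hgB

lemma Dat.uniq {n : ℕ} {X : Finset Pt} {L : Set Pt} {P A : Pt} {g q : Poly2} {t : Pt}
    (d : Dat n X L P A g q t) (hL : Ln L) (hAL : A ∈ L) {s : Pt} (hs : s ∈ L)
    (h : evalPt g s = 0) : s = t := by
  refine pt_eq hL ⟨g, d.hg, rfl⟩ ?_ hs d.tL h d.gt
  rintro rfl
  exact d.hA hAL

lemma dat_inj {n : ℕ} {X : Finset Pt} {L : Set Pt} (hL : Mx (n + 2) X L)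
    {m1 m2 : Set Pt} (hm1 : Mx (n + 1) (rm X L) m1) (hm2 : Mx (n + 1) (rm X L) m2) (hm12 : m1 ≠ m2)
    (hmiss1 : ∀ P ∈ X, P ∈ L → P ∉ m1) (hmiss2 : ∀ P ∈ X, P ∈ L → P ∉ m2)
    {P : Pt} (hP : P ∈ rm X L) (hPm1 : P ∈ m1) (hPm2 : P ∈ m2) {A B : Pt} (hA : A ∈ X) (hAL : A ∈ L)
    (hB : B ∈ X) (hBL : B ∈ L)
    {gA qA gB qB : Poly2} {t : Pt} (dA : Dat (n + 1) X L P A gA qA t)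
    (dB : Dat (n + 1) X L P B gB qB t) : A = B := by
  classical
  by_contra hAB
  obtain ⟨hPX, hPL⟩ := mem_rm.mp hP
  have hPt : P ≠ t := by rintro rfl; exact hPL dA.tL
  obtain ⟨c, hc, hgB⟩ := prop_of_two dA.hg dB.hg hPt dA.hP dA.gt dB.hP dB.gt
  have hiff : ∀ Q, evalPt gA Q ≠ 0 → evalPt gB Q ≠ 0 := by
    intro Q hQ; rw [hgB, ev_mul, ev_C]; exact mul_ne_zero hc hQ
  set s : Poly2 := C (evalPt qB P) * qA - C (evalPt qA P) * qB with hs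
  have hsD : D s (n + 2) := D_sub (D_C_mul _ dA.hq) (D_C_mul _ dB.hq)
  have hsP : evalPt s P = 0 := by simp only [hs, ev_sub, ev_mul, ev_C]; ring
  have hs0 : ∀ Q ∈ X, Q ≠ A → Q ≠ B → evalPt gA Q ≠ 0 → evalPt s Q = 0 := by
    intro Q hQ h1 h2 h3
    simp only [hs, ev_sub, ev_mul, ev_C]
    rw [dA.hv Q hQ h1 h3, dB.hv Q hQ h2 (hiff Q h3)]; ring
  have hsA : evalPt s A ≠ 0 := by
    simp only [hs, ev_sub, ev_mul, ev_C]
    rw [dB.hv A hA hAB (hiff A dA.hA), mul_zero, sub_zero]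
    exact mul_ne_zero dB.hqP dA.hqA
  have hsK : ∀ m, Ln m → (∀ P ∈ X, P ∈ L → P ∉ m) → P ∈ m → ∀ Q ∈ rm X L, Q ∈ m →
      evalPt s Q = 0 := by
    intro m hm hmiss hPm Q hQ hQm
    obtain ⟨hQX, hQL⟩ := mem_rm.mp hQ
    by_cases hQP : Q = P
    · rw [hQP, hsP]
    refine hs0 Q hQX (by rintro rfl; exact hQL hAL) (by rintro rfl; exact hQL hBL) fun h0 => ?_
    have := line_eq hm ⟨gA, dA.hg, rfl⟩ hQP hQm hPm h0 dA.hP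
    exact hmiss t dA.tX dA.tL (by rw [this]; exact dA.gt)
  have k1 := hsK m1 hm1.1 hmiss1 hPm1
  have k2 := hsK m2 hm2.1 hmiss2 hPm2
  obtain ⟨⟨l1, hl1, e1⟩, hc1⟩ := hm1
  obtain ⟨⟨l2, hl2, e2⟩, hc2⟩ := hm2
  obtain ⟨⟨l, hl, e⟩, hcl⟩ := hL
  have hLn : Ln L := ⟨l, hl, e⟩
  obtain ⟨s1, hs1, hD1⟩ := dvd_on hl1 (S := rm X L) hsD (by rw [← e1, hc1]) (by
    intro Q hQ hQm; rw [← e1] at hQm; exact k1 Q hQ hQm)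
  obtain ⟨s2, hs2, hD2⟩ := dvd_of_vanish hl2 ((on (rm X L) m2).erase P) (by
      intro Q hQ
      rw [e2] at hQ
      exact (mem_on.mp (Finset.mem_of_mem_erase hQ)).2) hD1
    (by rw [Finset.card_erase_of_mem (mem_on.mpr ⟨hP, hPm2⟩)]; omega) (by
      intro Q hQ
      have hQ1 := mem_on.mp (Finset.mem_of_mem_erase hQ)
      have h3 := k2 Q hQ1.1 hQ1.2
      rw [hs1, ev_mul] at h3
      refine (mul_eq_zero.mp h3).resolve_left fun h0 => ?_
      exact Finset.ne_of_mem_erase hQ (pt_eq ⟨l1, hl1, e1⟩ ⟨l2, hl2, e2⟩ hm12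
        (by rw [e1]; exact h0) hPm1 hQ1.2 hPm2))
  have ht : t ∈ ((on X L).erase A).erase B := by
    simp [dA.tA, dB.tA, dA.tX, dA.tL]
  have hBm : B ∈ (on X L).erase A := by simp [Ne.symm hAB, hB, hBL]
  have hAm : A ∈ on X L := by simp [hA, hAL]
  obtain ⟨s3, hs3, -⟩ := dvd_of_vanish hl ((((on X L).erase A).erase B).erase t) (by
      intro Q hQ
      simp only [Finset.mem_erase, mem_on] at hQ
      exact mem_zs.mp (e ▸ hQ.2.2.2.2)) hD2 (by
      rw [Finset.card_erase_of_mem ht, Finset.card_erase_of_mem hBm, Finset.card_erase_of_mem hAm]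
      omega) (by
      intro Q hQ
      simp only [Finset.mem_erase, mem_on] at hQ
      obtain ⟨h1, h2, h3, h4, h5⟩ := hQ
      have h6 := hs0 Q h4 h3 h2 (fun h0 => h1 (dA.uniq hLn hAL h5 h0))
      rw [hs1, hs2, ev_mul, ev_mul] at h6
      have n1 : evalPt l1 Q ≠ 0 := fun h0 => hmiss1 Q h4 h5 (by rw [e1]; exact h0)
      have n2 : evalPt l2 Q ≠ 0 := fun h0 => hmiss2 Q h4 h5 (by rw [e2]; exact h0)
      simpa [n1, n2] using h6)
  apply hsA
  have hlA : evalPt l A = 0 := by rw [e] at hAL; exact hAL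
  rw [hs1, hs2, hs3, ev_mul, ev_mul, ev_mul, hlA]; ring

lemma core {n : ℕ} {X : Finset Pt} {L : Set Pt} (h : IsGC (n + 2) X) (hL : Mx (n + 2) X L)
    {m1 m2 m3 : Set Pt} (hm1 : Mx (n + 1) (rm X L) m1) (hm2 : Mx (n + 1) (rm X L) m2)
    (hm3 : Mx (n + 1) (rm X L) m3) (hm12 : m1 ≠ m2) (hm13 : m1 ≠ m3) (hm23 : m2 ≠ m3)
    (hmiss1 : ∀ P ∈ X, P ∈ L → P ∉ m1) (hmiss2 : ∀ P ∈ X, P ∈ L → P ∉ m2) : False := by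
  classical
  have hK := rm_gc h hL
  obtain ⟨P, hP, hPm1, hPm2⟩ := mx_meet hK hm1 hm2 hm12
  have hPm3 : P ∉ m3 := fun h3 => no_three hK hm1 hm2 hm3 hm12 hm13 hm23 hPm1 hPm2 h3
  have hex : ∀ A ∈ on X L, ∃ g q t, Dat (n + 1) X L P A g q t := fun A hA =>
    dat_exists h hL hm1 hmiss1 hP hPm1 (mem_on.mp hA).1 (mem_on.mp hA).2
  choose! g q t hd using hex
  have hinj : Set.InjOn t (on X L : Finset Pt) := by
    intro A hA B hB he
    have hA' := Finset.mem_coe.mp hA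
    have hB' := Finset.mem_coe.mp hB
    have dA := hd A hA'
    have dB := hd B hB'
    rw [← he] at dB
    exact dat_inj hL hm1 hm2 hm12 hmiss1 hmiss2 hP hPm1 hPm2 (mem_on.mp hA').1 (mem_on.mp hA').2
      (mem_on.mp hB').1 (mem_on.mp hB').2 dA dB
  have hmaps : ∀ A ∈ on X L, t A ∈ on X L := fun A hA =>
    mem_on.mpr ⟨(hd A hA).tX, (hd A hA).tL⟩
  obtain ⟨hm3L, hm3c⟩ := hm3
  obtain ⟨l3, hl3, e3⟩ := id hm3L
  by_cases hmiss3 : ∀ P ∈ X, P ∈ L → P ∉ m3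
  · have hex : ∀ A ∈ on X L, ∃ R ∈ on (rm X L) m3, evalPt (g A) R = 0 := by
      intro A hA
      by_contra hcon
      push Not at hcon
      have dA := hd A hA
      obtain ⟨hAX, hAL⟩ := mem_on.mp hA
      obtain ⟨r, hr, hD⟩ := dvd_of_vanish hl3 (on (rm X L) m3)
        (fun Q hQ => by have := (mem_on.mp hQ).2; rw [e3] at this; exact this) dA.hq
        (by rw [hm3c]) (by
          intro Q hQ
          have h1 := mem_rm.mp (mem_on.mp hQ).1
          exact dA.hv Q h1.1 (by rintro rfl; exact h1.2 hAL) (hcon Q hQ))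
      have e : g A * q A = l3 * (g A * r) := by rw [hr]; ring
      obtain ⟨s, hs, hsL, -, h0⟩ := claim0 hL hAX hAL (g := l3) (q := g A * r)
        (D_mul1 dA.hg hD) (by rw [← e, ev_mul]; exact mul_ne_zero dA.hA dA.hqA) (by
          intro B hB hBA
          rw [← e, ev_mul]
          by_cases hz : evalPt (g A) B = 0
          · rw [hz, zero_mul]
          · rw [dA.hv B hB hBA hz, mul_zero])
      exact hmiss3 s hs hsL (by rw [e3]; exact h0)
    choose! R hR1 hR2 using hex
    have hle := Finset.card_le_card_of_injOn R hR1 (by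
      intro A hA B hB he
      apply hinj hA hB
      have hA' := Finset.mem_coe.mp hA
      have hB' := Finset.mem_coe.mp hB
      have dA := hd A hA'
      have dB := hd B hB'
      have hRP : R A ≠ P := by
        intro h0; exact hPm3 (h0 ▸ (mem_on.mp (hR1 A hA')).2)
      have hz : zeroSet (g A) = zeroSet (g B) := line_eq ⟨_, dA.hg, rfl⟩ ⟨_, dB.hg, rfl⟩ hRP
        (hR2 A hA') dA.hP (mem_zs.mpr (he ▸ hR2 B hB')) dB.hP
      exact dB.uniq hL.1 (mem_on.mp hB').2 dA.tL (by
        rw [← mem_zs, ← hz]; exact dA.gt))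
    rw [hL.2, hm3c] at hle
    omega
  · push Not at hmiss3
    obtain ⟨t3, ht3, ht3L, ht3m⟩ := hmiss3
    obtain ⟨A, hA, hAt⟩ := Finset.surjOn_of_injOn_of_card_le t hmaps hinj le_rfl
      (Finset.mem_coe.mpr (mem_on.mpr ⟨ht3, ht3L⟩))
    have hA' := Finset.mem_coe.mp hA
    obtain ⟨hAX, hAL⟩ := mem_on.mp hA'
    have dA := hd A hA'
    rw [hAt] at dA
    obtain ⟨r, hr, hD⟩ := dvd_of_vanish hl3 (on (rm X L) m3)
        (fun Q hQ => by have := (mem_on.mp hQ).2; rw [e3] at this; exact this) dA.hq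
        (by rw [hm3c]) (by
          intro Q hQ
          have h1 := mem_rm.mp (mem_on.mp hQ).1
          refine dA.hv Q h1.1 (by rintro rfl; exact h1.2 hAL) fun h0 => hPm3 ?_
          have : m3 = zeroSet (g A) := line_eq hm3L ⟨_, dA.hg, rfl⟩
            (show Q ≠ t3 by rintro rfl; exact h1.2 ht3L) (mem_on.mp hQ).2 ht3m h0 dA.gt
          rw [this]; exact dA.hP)
    have hq3 : evalPt (q A) t3 = 0 := by
      rw [hr, ev_mul, mem_zs.mp (e3 ▸ ht3m), zero_mul]
    obtain ⟨s, hs, hsL, hsA, h0⟩ := claim00 hL hAX hAL (g := 1) (q := q A) dA.hq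
      (by simpa using dA.hqA) (by
        intro B hB hBL hBA
        rw [ev_mul]
        by_cases hBt : B = t3
        · rw [hBt, hq3, mul_zero]
        · rw [dA.hv B hB hBA (fun h0 => hBt (dA.uniq hL.1 hAL hBL h0)), mul_zero])
    simp at h0


/-- `X` is a GC set of degree `n` and the GM conjecture holds up to degree `n` -/
def G (n : ℕ) (X : Finset Pt) : Prop := IsGC n X ∧ ∀ m ≤ n, GM m

lemma G.rm {n : ℕ} {X : Finset Pt} (h : G (n + 1) X) {L : Set Pt} (hL : Mx (n + 1) X L) :
    G n (rm X L) := ⟨rm_gc h.1 hL, fun m hm => h.2 m (by omega)⟩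

lemma nodesOn_eq (X : Finset Pt) (l : Poly2) : nodesOn X l = on X (zeroSet l) := by
  ext A; simp [nodesOn, on, mem_zs]

lemma mx_of {n : ℕ} {X : Finset Pt} {l : Poly2} (h : IsMaximalLine n X l) : Mx n X (zeroSet l) :=
  ⟨⟨l, h.1, rfl⟩, by rw [← nodesOn_eq]; exact h.2⟩

lemma gm_ex {n : ℕ} {X : Finset Pt} (h : G n X) : ∃ L, Mx n X L := by
  obtain ⟨l, hl⟩ := h.2 n le_rfl X h.1
  exact ⟨_, mx_of hl⟩

lemma gc1_line {X : Finset Pt} (h : IsGC 1 X) {P Q : Pt} (hP : P ∈ X) (hQ : Q ∈ X) (hPQ : P ≠ Q)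
    {L : Set Pt} (hL : Ln L) (hPL : P ∈ L) (hQL : Q ∈ L) : Mx 1 X L := by
  classical
  refine ⟨hL, le_antisymm (card_le h hL) ?_⟩
  have : 1 < (on X L).card := Finset.one_lt_card.mpr ⟨P, by simp [hP, hPL], Q, by simp [hQ, hQL], hPQ⟩
  omega

lemma three_le {α : Type*} {s : Finset α} {a b c : α} (ha : a ∈ s) (hb : b ∈ s) (hc : c ∈ s)
    (hab : a ≠ b) (hac : a ≠ c) (hbc : b ≠ c) : 3 ≤ s.card :=
  Finset.two_lt_card.mpr ⟨a, ha, b, hb, c, hc, hab, hac, hbc⟩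

lemma three_of {α : Type*} {s : Finset α} (h : 3 ≤ s.card) : ∃ a b c, a ∈ s ∧ b ∈ s ∧ c ∈ s ∧
    a ≠ b ∧ a ≠ c ∧ b ≠ c := by
  obtain ⟨a, ha, b, hb, c, hc, h1, h2, h3⟩ := Finset.two_lt_card.mp h
  exact ⟨a, b, c, ha, hb, hc, h1, h2, h3⟩

lemma three_max {n : ℕ} : ∀ {X : Finset Pt}, G (n + 1) X → 3 ≤ (ML (n + 1) X).card := by
  induction n with
  | zero =>
    intro X h
    have hc : X.card = 3 := h.1.1.1
    obtain ⟨a, b, c, hab, hac, hbc, rfl⟩ := Finset.card_eq_three.mp hc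
    obtain ⟨L1, h1, h1a, h1b⟩ := exists_line hab
    obtain ⟨L2, h2, h2a, h2c⟩ := exists_line hac
    obtain ⟨L3, h3, h3b, h3c⟩ := exists_line hbc
    have nc : ∀ L, Ln L → a ∈ L → b ∈ L → c ∈ L → False := by
      intro L hL h1 h2 h3
      have := card_le h.1 hL
      have h4 : 3 ≤ (on {a, b, c} L).card := three_le (a := a) (b := b) (c := c) (by simp [h1])
        (by simp [h2]) (by simp [h3]) hab hac hbc
      omega
    refine three_le (a := L1) (b := L2) (c := L3) ?_ ?_ ?_ ?_ ?_ ?_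
    · exact mem_ML.mpr (gc1_line h.1 (P := a) (Q := b) (by simp) (by simp) hab h1 h1a h1b)
    · exact mem_ML.mpr (gc1_line h.1 (P := a) (Q := c) (by simp) (by simp) hac h2 h2a h2c)
    · exact mem_ML.mpr (gc1_line h.1 (P := b) (Q := c) (by simp) (by simp) hbc h3 h3b h3c)
    · rintro rfl; exact nc L1 h1 h1a h1b h2c
    · rintro rfl; exact nc L1 h1 h1a h1b h3c
    · rintro rfl; exact nc L2 h2 h2a h3b h3c
  | succ n ih =>
    intro X h
    obtain ⟨L, hL⟩ := gm_ex h
    have hK := h.rm hL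
    obtain ⟨m1, m2, m3, h1, h2, h3, h12, h13, h23⟩ := three_of (ih hK)
    rw [mem_ML] at h1 h2 h3
    have key : ∀ {a b c}, Mx (n + 1) (rm X L) a → Mx (n + 1) (rm X L) b → Mx (n + 1) (rm X L) c →
        a ≠ b → a ≠ c → b ≠ c → Mx (n + 2) X a ∨ Mx (n + 2) X b := by
      intro a b c ha hb hc hab hac hbc
      by_contra hcon
      push Not at hcon
      exact core h.1 hL ha hb hc hab hac hbc (mx_miss h.1 hL.1 ha hcon.1)
        (mx_miss h.1 hL.1 hb hcon.2)
    have fin : ∀ {a b}, Mx (n + 1) (rm X L) a → Mx (n + 1) (rm X L) b → a ≠ b → Mx (n + 2) X a →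
        Mx (n + 2) X b → 3 ≤ (ML (n + 2) X).card := by
      intro a b ha hb hab ha' hb'
      exact three_le (mem_ML.mpr hL) (mem_ML.mpr ha') (mem_ML.mpr hb') (rm_ne ha) (rm_ne hb) hab
    rcases key h1 h2 h3 h12 h13 h23 with k | k
    · rcases key h2 h3 h1 h23 h12.symm h13.symm with k' | k'
      · exact fin h1 h2 h12 k k'
      · exact fin h1 h3 h13 k k'
    · rcases key h1 h3 h2 h13 h12 h23.symm with k' | k'
      · exact fin h2 h1 h12.symm k k'
      · exact fin h2 h3 h23 k k'

lemma exists_third {n : ℕ} {X : Finset Pt} (h : G (n + 1) X) (a b : Set Pt) :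
    ∃ c, Mx (n + 1) X c ∧ c ≠ a ∧ c ≠ b := by
  classical
  have h3 := three_max h
  have : (({a, b} : Finset (Set Pt))).card < (ML (n + 1) X).card :=
    lt_of_le_of_lt Finset.card_le_two (by omega)
  obtain ⟨c, hc, hn⟩ := Finset.exists_mem_notMem_of_card_lt_card this
  simp only [Finset.mem_insert, Finset.mem_singleton, not_or] at hn
  exact ⟨c, mem_ML.mp hc, hn.1, hn.2⟩

lemma lemM {n : ℕ} {X : Finset Pt} (h : G (n + 2) X) {L m1 m2 : Set Pt} (hL : Mx (n + 2) X L)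
    (h1 : Mx (n + 1) (rm X L) m1) (h2 : Mx (n + 1) (rm X L) m2) (h12 : m1 ≠ m2) :
    Mx (n + 2) X m1 ∨ Mx (n + 2) X m2 := by
  by_contra hcon
  push Not at hcon
  obtain ⟨m3, h3, h31, h32⟩ := exists_third (h.rm hL) m1 m2
  exact core h.1 hL h1 h2 h3 h12 h31.symm h32.symm (mx_miss h.1 hL.1 h1 hcon.1)
        (mx_miss h.1 hL.1 h2 hcon.2)

/-- structure of a quadratic GC set relative to two maximal lines -/
lemma tri {W : Finset Pt} (h : G 2 W) {a b : Set Pt} (ha : Mx 2 W a) (hb : Mx 2 W b) (hab : a ≠ b) :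
    ∃ g, ∃ O ∈ W, ∃ P ∈ W, ∃ Q ∈ W, Mx 2 W g ∧ g ≠ a ∧ g ≠ b ∧ O ∈ g ∧ O ∉ a ∧ O ∉ b ∧
      P ∈ g ∧ P ∈ a ∧ P ∉ b ∧ Q ∈ g ∧ Q ∉ a ∧ Q ∈ b := by
  classical
  obtain ⟨g, hg, hga, hgb⟩ := exists_third h a b
  obtain ⟨P, hP, hPg, hPa⟩ := mx_meet h.1 hg ha hga
  obtain ⟨Q, hQ, hQg, hQb⟩ := mx_meet h.1 hg hb hgb
  have hPb : P ∉ b := fun h0 => no_three h.1 hg ha hb hga hgb hab hPg hPa h0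
  have hQa : Q ∉ a := fun h0 => no_three h.1 hg ha hb hga hgb hab hQg h0 hQb
  have : (({P, Q} : Finset Pt)).card < (on W g).card := by
    rw [hg.2]; exact lt_of_le_of_lt Finset.card_le_two (by omega)
  obtain ⟨O, hO, hn⟩ := Finset.exists_mem_notMem_of_card_lt_card this
  simp only [Finset.mem_insert, Finset.mem_singleton, not_or] at hn
  obtain ⟨hOW, hOg⟩ := mem_on.mp hO
  refine ⟨g, O, hOW, P, hP, Q, hQ, hg, hga, hgb, hOg, ?_, ?_, hPg, hPa, hPb, hQg, hQa, hQb⟩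
  · exact fun h0 => hn.1 (pt_eq hg.1 ha.1 hga hOg hPg h0 hPa)
  · exact fun h0 => hn.2 (pt_eq hg.1 hb.1 hgb hOg hQg h0 hQb)

open Classical in
/-- remove a finite set of lines -/
noncomputable def rms (X : Finset Pt) (s : Finset (Set Pt)) : Finset Pt :=
  X.filter (fun A => ∀ L ∈ s, A ∉ L)

@[simp] lemma mem_rms {X : Finset Pt} {s : Finset (Set Pt)} {A : Pt} :
    A ∈ rms X s ↔ A ∈ X ∧ ∀ L ∈ s, A ∉ L := by simp [rms]

open Classical in
lemma rms_insert (X : Finset Pt) (a : Set Pt) (s : Finset (Set Pt)) :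
    rms X (insert a s) = rms (rm X a) s := by
  ext A; simp [and_assoc]

open Classical in
lemma rms_insert' (X : Finset Pt) (a : Set Pt) (s : Finset (Set Pt)) :
    rms X (insert a s) = rm (rms X s) a := by
  ext A; simp; tauto

lemma rms_gc (s : Finset (Set Pt)) : ∀ {m : ℕ} {X : Finset Pt}, G (m + s.card) X →
    (∀ L ∈ s, Mx (m + s.card) X L) → G m (rms X s) ∧
    ∀ L, L ∉ s → Mx (m + s.card) X L → Mx m (rms X s) L := by
  classical
  induction s using Finset.induction_on with
  | empty =>
    intro m X h _
    have : rms X ∅ = X := by ext A; simp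
    rw [this]
    exact ⟨h, fun L _ hL => hL⟩
  | insert a s ha ih =>
    intro m X h hs
    rw [Finset.card_insert_of_notMem ha] at h hs ⊢
    rw [rms_insert]
    have haX := hs a (Finset.mem_insert_self _ _)
    obtain ⟨i1, i2⟩ := ih (h.rm haX) (fun L hL => mx_rm h.1 haX (hs L (Finset.mem_insert_of_mem hL))
      (by rintro rfl; exact ha hL))
    refine ⟨i1, fun L hL hm => ?_⟩
    simp only [Finset.mem_insert, not_or] at hL
    exact i2 L hL.2 (mx_rm h.1 haX hm (Ne.symm hL.1))

lemma rms_ne (s : Finset (Set Pt)) : ∀ {m : ℕ} {X : Finset Pt} {M : Set Pt},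
    (∀ L ∈ s, Ln L) → NE m (rms X s) M → NE (m + s.card) X M := by
  classical
  induction s using Finset.induction_on with
  | empty =>
    intro m X M _ h
    have : rms X ∅ = X := by ext A; simp
    rw [this] at h
    exact h
  | insert a s ha ih =>
    intro m X M hs h
    rw [Finset.card_insert_of_notMem ha]
    rw [rms_insert] at h
    exact ne_lift (hs a (Finset.mem_insert_self _ _))
      (ih (fun L hL => hs L (Finset.mem_insert_of_mem hL)) h)


lemma mu_rm {n : ℕ} {X : Finset Pt} (h : G (n + 2) X) {L : Set Pt} (hL : Mx (n + 2) X L) :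
    (ML (n + 2) X).card ≤ (ML (n + 1) (rm X L)).card + 1 := by
  classical
  have : (ML (n + 2) X).erase L ⊆ ML (n + 1) (rm X L) := by
    intro M hM
    exact mem_ML.mpr (mx_rm h.1 hL (mem_ML.mp (Finset.mem_of_mem_erase hM))
      (Finset.ne_of_mem_erase hM).symm)
  have h2 := Finset.card_le_card this
  rw [Finset.card_erase_of_mem (show L ∈ ML (n + 2) X from mem_ML.mpr hL)] at h2
  omega

lemma up2 {n : ℕ} {Z : Finset Pt} (h : G (n + 2) Z) {i j s : Set Pt} (hi : Mx (n + 2) Z i)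
    (hj : Mx (n + 2) Z j) (hij : i ≠ j) (h1 : Mx (n + 1) (rm Z i) s) (h2 : Mx (n + 1) (rm Z j) s) :
    Mx (n + 2) Z s := by
  have hi' := mx_rm h.1 hj hi hij.symm
  obtain ⟨P, hP, hPi, hPs⟩ := mx_meet (h.rm hj).1 hi' h2 (rm_ne h1)
  exact mx_up h.1 hi.1 h1 ⟨P, (mem_rm.mp hP).1, hPi, hPs⟩

lemma rms_erase {X : Finset Pt} {s : Finset (Set Pt)} [DecidableEq (Set Pt)] {j : Set Pt}
    (hj : j ∈ s) : rms X s = rm (rms X (s.erase j)) j := by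
  ext A
  simp only [mem_rms, mem_rm, Finset.mem_erase]
  constructor
  · rintro ⟨h1, h2⟩
    exact ⟨⟨h1, fun L hL => h2 L hL.2⟩, h2 j hj⟩
  · rintro ⟨⟨h1, h2⟩, h3⟩
    refine ⟨h1, fun L hL => ?_⟩
    by_cases hLj : L = j
    · rw [hLj]; exact h3
    · exact h2 L ⟨hLj, hL⟩

/-- a node set on a maximal line of a degree one set has just two nodes -/
lemma two_nodes {n : ℕ} {X : Finset Pt} {i : Set Pt} (hi : Mx n X i) (hn : n = 1) {P Q R : Pt}
    (hP : P ∈ X) (hQ : Q ∈ X) (hR : R ∈ X) (hPi : P ∈ i) (hQi : Q ∈ i) (hRi : R ∈ i)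
    (hPQ : P ≠ Q) : R = P ∨ R = Q := by
  by_contra hcon
  push Not at hcon
  have := three_le (mem_on.mpr ⟨hP, hPi⟩) (mem_on.mpr ⟨hQ, hQi⟩) (mem_on.mpr ⟨hR, hRi⟩) hPQ
    hcon.1.symm hcon.2.symm
  rw [hi.2] at this
  omega

lemma ne1 {Y : Finset Pt} (h : G 1 Y) {L : Set Pt} (hL : Ln L) {P Q : Pt} (hP : P ∈ Y) (hQ : Q ∈ Y)
    (hPQ : P ≠ Q) (hPL : P ∈ L) (hQL : Q ∈ L) : NE 1 Y L :=
  ne_of_mx h.1 (gc1_line h.1 hP hQ hPQ hL hPL hQL)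

lemma U_b0 {W : Finset Pt} (h : G 2 W) {i j L : Set Pt} (hi : Mx 2 W i) (hj : Mx 2 W j) (hij : i ≠ j)
    (hL : Ln L) {A B : Pt} (hA : A ∈ W) (hB : B ∈ W) (hAi : A ∈ i) (hAj : A ∉ j)
    (hBj : B ∈ j) (hAL : A ∈ L) (hBL : B ∈ L)
    (hO : ∀ O ∈ W, O ∉ i → O ∉ j → O ∉ L) :
    NE 2 W L ∨ (∃ g, Ln g ∧ ∃ O ∈ W, O ∉ i ∧ O ∉ j ∧ O ∈ g ∧ A ∈ g ∧ ∃ Q ∈ W, Q ∈ g ∧ Q ∈ j ∧ Q ∉ i ∧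
      Q ≠ B) ∨ (∃ g, Ln g ∧ ∃ O ∈ W, O ∉ i ∧ O ∉ j ∧ O ∈ g ∧ B ∈ g ∧ ∃ Q ∈ W, Q ∈ g ∧ Q ∈ i ∧ Q ∉ j ∧
      Q ≠ A) := by
  have hAB : A ≠ B := by rintro rfl; exact hAj hBj
  obtain ⟨g, O, hOW, P, hP, Q, hQ, hg, hga, hgb, hOg, hOi, hOj, hPg, hPi, hPj, hQg, hQi, hQj⟩ :=
    tri h hi hj hij
  by_cases h1 : P = A
  · by_cases h2 : Q = B
    · subst h1; subst h2
      have := line_eq hg.1 hL hAB hPg hQg hAL hBL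
      subst this
      exact absurd hOg (hO O hOW hOi hOj)
    · right; left
      subst h1
      exact ⟨g, hg.1, O, hOW, hOi, hOj, hOg, hPg, Q, hQ, hQg, hQj, hQi, h2⟩
  · by_cases h2 : Q = B
    · right; right
      subst h2
      exact ⟨g, hg.1, O, hOW, hOi, hOj, hOg, hQg, P, hP, hPg, hPi, hPj, h1⟩
    · left
      refine ne_lift hg.1 (ne1 (h.rm hg) hL (P := A) (Q := B) ?_ ?_ hAB hAL hBL)
      · exact mem_rm.mpr ⟨hA, fun h0 => h1 (pt_eq hg.1 hi.1 hga hPg h0 hPi hAi)⟩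
      · exact mem_rm.mpr ⟨hB, fun h0 => h2 (pt_eq hg.1 hj.1 hgb hQg h0 hQj hBj)⟩

lemma U_b1 {Z : Finset Pt} (h : G 3 Z) {i j L : Set Pt} (hi : Mx 3 Z i) (hj : Mx 3 Z j) (hij : i ≠ j)
    (hL : Ln L) {A B : Pt} (hA : A ∈ Z) (hB : B ∈ Z) (hAi : A ∈ i) (hAj : A ∉ j)
    (hBj : B ∈ j) (hBi : B ∉ i) (hAL : A ∈ L) (hBL : B ∈ L)
    (hs : ∀ s, Mx 1 (rm (rm Z i) j) s → A ∉ s ∧ B ∉ s) : NE 3 Z L := by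
  classical
  have hAB : A ≠ B := by rintro rfl; exact hAj hBj
  have gi := h.rm hi
  have gj := h.rm hj
  have ji := mx_rm h.1 hi hj hij
  have ij := mx_rm h.1 hj hi hij.symm
  have hK := gi.rm ji
  have hcomm := rm_comm Z i j
  -- two sides hit by both
  have two : ∀ s t, s ≠ t → Mx 2 (rm Z i) s → Mx 2 (rm Z j) s → Mx 2 (rm Z i) t →
      Mx 2 (rm Z j) t → Mx 1 (rm (rm Z i) j) s → Mx 1 (rm (rm Z i) j) t → NE 3 Z L := by
    intro s t hst s1 s2 t1 t2 ks kt
    have ms := up2 h hi hj hij s1 s2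
    have mt := up2 h hi hj hij t1 t2
    have mt' := mx_rm h.1 ms mt hst
    refine ne_lift ms.1 (ne_lift mt'.1 (ne1 ((h.rm ms).rm mt') hL (P := A) (Q := B) ?_ ?_ hAB hAL hBL))
    · simp [hA, (hs s ks).1, (hs t kt).1]
    · simp [hB, (hs s ks).2, (hs t kt).2]
  have main : ∀ p q r, p ≠ q → p ≠ r → q ≠ r → Mx 1 (rm (rm Z i) j) p → Mx 1 (rm (rm Z i) j) q →
      Mx 1 (rm (rm Z i) j) r → ¬ Mx 2 (rm Z j) p → Mx 2 (rm Z i) p → ¬ Mx 2 (rm Z i) q →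
      Mx 2 (rm Z j) q → Mx 2 (rm Z i) r → Mx 2 (rm Z j) r → NE 3 Z L := by
    intro p q r hpq hpr hqr kp kq kr np mp nq mq ri rj
    have mr := up2 h hi hj hij ri rj
    have hri : r ≠ i := (rm_ne ri).symm
    have hrj : r ≠ j := (rm_ne rj).symm
    have iW := mx_rm h.1 mr hi hri
    have jW := mx_rm h.1 mr hj hrj
    have gW := h.rm mr
    obtain ⟨g, O, hOW, P, hP, Q, hQ, hg, hga, hgb, hOg, hOi, hOj, hPg, hPi, hPj, hQg, hQi, hQj⟩ :=
      tri gW iW jW hij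
    obtain ⟨hOZ, hOr⟩ := mem_rm.mp hOW
    obtain ⟨hPZ, hPr⟩ := mem_rm.mp hP
    obtain ⟨hQZ, hQr⟩ := mem_rm.mp hQ
    -- O lies on both p and q
    have hOpq : O ∈ p ∧ O ∈ q := by
      have g0 := hK.rm kr
      obtain ⟨O', hO'⟩ := gc0 g0.1
      have hO1 : O ∈ rm (rm (rm Z i) j) r := by simp [hOZ, hOr, hOi, hOj]
      have e : O = O' := by rw [hO'] at hO1; simpa using hO1
      have aux : ∀ x, x ≠ r → Mx 1 (rm (rm Z i) j) x → O ∈ x := by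
        intro x hx kx
        have := mx_rm hK.1 kr kx hx.symm
        obtain ⟨R, hR⟩ := Finset.card_pos.mp
          (show 0 < (on (rm (rm (rm Z i) j) r) x).card by rw [this.2]; omega)
        obtain ⟨hR1, hR2⟩ := mem_on.mp hR
        rw [hO'] at hR1
        have : R = O' := by simpa using hR1
        rw [e, ← this]; exact hR2
      exact ⟨aux p hpr kp, aux q hqr kq⟩
    -- P is A
    have hPA : P = A := by
      have y1 := mx_rm gj.1 rj mq hqr.symm
      have y2 := mx_rm gj.1 rj ij hri
      have hqi : q ≠ i := by
        intro h0; rw [h0, hcomm] at kq; exact rm_ne kq rfl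
      obtain ⟨R, hR, hRq, hRi⟩ := mx_meet (gj.rm rj).1 y1 y2 hqi
      have hRA : R ≠ A := by rintro rfl; exact (hs q kq).1 hRq
      rcases two_nodes y2 rfl (P := R) (Q := A) (R := P) hR
        (by simp [hA, hAj, (hs r kr).1]) (by simp [hPZ, hPj, hPr]) hRi hAi hPi hRA with h0 | h0
      · exfalso
        subst h0
        have hOP : O ≠ P := by rintro rfl; exact hOi hPi
        have : g = q := line_eq hg.1 kq.1 hOP hOg hPg hOpq.2 hRq
        subst this
        exact nq (mx_up gi.1 hj.1 kq ⟨Q, by simp [hQZ, hQi], hQj, hQg⟩)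
      · exact h0
    have hQB : Q = B := by
      have y1 := mx_rm gi.1 ri mp hpr.symm
      have y2 := mx_rm gi.1 ri ji hrj
      have hpj : p ≠ j := by
        intro h0; rw [h0] at kp; exact rm_ne kp rfl
      obtain ⟨R, hR, hRq, hRi⟩ := mx_meet (gi.rm ri).1 y1 y2 hpj
      have hRA : R ≠ B := by rintro rfl; exact (hs p kp).2 hRq
      rcases two_nodes y2 rfl (P := R) (Q := B) (R := Q) hR
        (by simp [hB, hBi, (hs r kr).2]) (by simp [hQZ, hQi, hQr]) hRi hBj hQj hRA with h0 | h0
      · exfalso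
        subst h0
        have hOP : O ≠ Q := by rintro rfl; exact hOj hQj
        have : g = p := line_eq hg.1 kp.1 hOP hOg hQg hOpq.1 hRq
        subst this
        rw [hcomm] at kp
        exact np (mx_up gj.1 hi.1 kp ⟨P, by simp [hPZ, hPj], hPi, hPg⟩)
      · exact h0
    subst hPA; subst hQB
    have : g = L := line_eq hg.1 hL hAB hPg hQg hAL hBL
    subst this
    exact ne_lift mr.1 (ne_of_mx gW.1 hg)
  -- combinatorics of the three sides
  have Mi : ∀ s t, s ≠ t → Mx 1 (rm (rm Z i) j) s → Mx 1 (rm (rm Z i) j) t →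
      Mx 2 (rm Z i) s ∨ Mx 2 (rm Z i) t := fun s t hst ks kt => lemM gi ji ks kt hst
  have Mj : ∀ s t, s ≠ t → Mx 1 (rm (rm Z i) j) s → Mx 1 (rm (rm Z i) j) t →
      Mx 2 (rm Z j) s ∨ Mx 2 (rm Z j) t := fun s t hst ks kt => by
    rw [hcomm] at ks kt
    exact lemM gj ij ks kt hst
  obtain ⟨x, y, z, hx, hy, hz, hxy, hxz, hyz⟩ := three_of (three_max hK)
  rw [mem_ML] at hx hy hz
  have step : ∀ p q r, p ≠ q → p ≠ r → q ≠ r → Mx 1 (rm (rm Z i) j) p → Mx 1 (rm (rm Z i) j) q →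
      Mx 1 (rm (rm Z i) j) r → Mx 2 (rm Z i) q → Mx 2 (rm Z i) r → NE 3 Z L := by
    intro p q r hpq hpr hqr kp kq kr iq ir
    by_cases jq : Mx 2 (rm Z j) q
    · by_cases jr : Mx 2 (rm Z j) r
      · exact two q r hqr iq jq ir jr kq kr
      · have jp := (Mj p r hpr kp kr).resolve_right jr
        by_cases ip : Mx 2 (rm Z i) p
        · exact two q p hpq.symm iq jq ip jp kq kp
        · exact main r p q hpr.symm hqr.symm hpq kr kp kq jr ir ip jp iq jq
    · have jr := (Mj q r hqr kq kr).resolve_left jq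
      have jp := (Mj p q hpq kp kq).resolve_right jq
      by_cases ip : Mx 2 (rm Z i) p
      · exact two r p hpr.symm ir jr ip jp kr kp
      · exact main q p r hpq.symm hqr hpr kq kp kr jq iq ip jp ir jr
  by_cases ix : Mx 2 (rm Z i) x
  · by_cases iy : Mx 2 (rm Z i) y
    · exact step z x y hxz.symm hyz.symm hxy hz hx hy ix iy
    · have iz := (Mi y z hyz hy hz).resolve_left iy
      exact step y x z hxy.symm hyz hxz hy hx hz ix iz
  · have iy := (Mi x y hxy hx hy).resolve_left ix
    have iz := (Mi x z hxz hx hz).resolve_left ix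
    exact step x y z hxy hxz hyz hx hy hz iy iz


lemma rms_gc' {s : Finset (Set Pt)} {m n : ℕ} {X : Finset Pt} (hn : n = m + s.card) (h : G n X)
    (hs : ∀ L ∈ s, Mx n X L) : G m (rms X s) ∧ ∀ L, L ∉ s → Mx n X L → Mx m (rms X s) L := by
  subst hn; exact rms_gc s h hs

lemma rms_ne' {s : Finset (Set Pt)} {m n : ℕ} {X : Finset Pt} {M : Set Pt} (hn : n = m + s.card)
    (hs : ∀ L ∈ s, Ln L) (h : NE m (rms X s) M) : NE n X M := by
  subst hn; exact rms_ne s hs h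

lemma tour {α : Type*} {R : α → α → Prop} {s : Finset α} (hs : 4 ≤ s.card)
    (h1 : ∀ x ∈ s, ∀ y ∈ s, x ≠ y → R x y ∨ R y x)
    (h2 : ∀ x ∈ s, ∀ y ∈ s, ∀ z ∈ s, x ≠ z → y ≠ z → R x z → R y z → x = y) : False := by
  classical
  obtain ⟨t, hts, ht⟩ := Finset.exists_subset_card_eq hs
  obtain ⟨a, ha⟩ := Finset.card_pos.mp (show 0 < t.card by omega)
  obtain ⟨b, c, d, hbc, hbd, hcd, he⟩ := Finset.card_eq_three.mp
    (show (t.erase a).card = 3 by rw [Finset.card_erase_of_mem ha]; omega)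
  have hb : b ∈ t.erase a := by rw [he]; simp
  have hc : c ∈ t.erase a := by rw [he]; simp
  have hd : d ∈ t.erase a := by rw [he]; simp
  rw [Finset.mem_erase] at hb hc hd
  have ha := hts ha
  obtain ⟨hba, hb⟩ := hb
  obtain ⟨hca, hc⟩ := hc
  obtain ⟨hda, hd⟩ := hd
  have hb := hts hb
  have hc := hts hc
  have hd := hts hd
  have e1 := h1 a ha b hb hba.symm
  have e2 := h1 a ha c hc hca.symm
  have e3 := h1 a ha d hd hda.symm
  have e4 := h1 b hb c hc hbc
  have e5 := h1 b hb d hd hbd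
  have e6 := h1 c hc d hd hcd
  have A1 := h2 b hb c hc a ha hba hca
  have A2 := h2 b hb d hd a ha hba hda
  have A3 := h2 c hc d hd a ha hca hda
  have B1 := h2 a ha c hc b hb hba.symm hbc.symm
  have B2 := h2 a ha d hd b hb hba.symm hbd.symm
  have B3 := h2 c hc d hd b hb hbc.symm hbd.symm
  have C1 := h2 a ha b hb c hc hca.symm hbc
  have C2 := h2 a ha d hd c hc hca.symm hcd.symm
  have C3 := h2 b hb d hd c hc hbc hcd.symm
  have D1 := h2 a ha b hb d hd hda.symm hbd
  have D2 := h2 a ha c hc d hd hda.symm hcd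
  have D3 := h2 b hb c hc d hd hbd hcd
  clear h1 h2
  rcases e1 with e1 | e1 <;> rcases e2 with e2 | e2 <;> rcases e3 with e3 | e3 <;>
    rcases e4 with e4 | e4 <;> rcases e5 with e5 | e5 <;> rcases e6 with e6 | e6 <;>
    first
    | exact absurd (A1 (by assumption) (by assumption)) (hbc)
    | exact absurd (A2 (by assumption) (by assumption)) (hbd)
    | exact absurd (A3 (by assumption) (by assumption)) (hcd)
    | exact absurd (B1 (by assumption) (by assumption)) (hca.symm)
    | exact absurd (B2 (by assumption) (by assumption)) (hda.symm)
    | exact absurd (B3 (by assumption) (by assumption)) (hcd)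
    | exact absurd (C1 (by assumption) (by assumption)) (hba.symm)
    | exact absurd (C2 (by assumption) (by assumption)) (hda.symm)
    | exact absurd (C3 (by assumption) (by assumption)) (hbd)
    | exact absurd (D1 (by assumption) (by assumption)) (hba.symm)
    | exact absurd (D2 (by assumption) (by assumption)) (hca.symm)
    | exact absurd (D3 (by assumption) (by assumption)) (hbc)

lemma U_n {n : ℕ} {X : Finset Pt} (h : G (n + 1) X) {L : Set Pt} (hL : Ln L) (hn : 4 ≤ n + 1)
    (hc : (on X L).card = n + 1) (hb : (ML (n + 1) X).card = n + 1) (A : Set Pt → Pt)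
    (hA : ∀ i ∈ ML (n + 1) X, A i ∈ X ∧ A i ∈ i ∧ A i ∈ L)
    (hA' : ∀ i ∈ ML (n + 1) X, ∀ j ∈ ML (n + 1) X, A i ∈ j → i = j) : NE (n + 1) X L := by
  classical
  set S := ML (n + 1) X with hS
  by_contra hNE
  have hSm : ∀ i ∈ S, Mx (n + 1) X i := fun i hi => mem_ML.mp hi
  have hAinj : ∀ i ∈ S, ∀ j ∈ S, A i = A j → i = j := fun i hi j hj he =>
    hA' i hi j hj (he ▸ (hA j hj).2.1)
  -- every node of L is some A i
  have hsurj : ∀ P ∈ X, P ∈ L → ∃ i ∈ S, A i = P := by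
    intro P hP hPL
    have himg : S.image A = on X L := by
      apply Finset.eq_of_subset_of_card_le
      · intro Q hQ
        obtain ⟨i, hi, rfl⟩ := Finset.mem_image.mp hQ
        exact mem_on.mpr ⟨(hA i hi).1, (hA i hi).2.2⟩
      · rw [hc, Finset.card_image_of_injOn (fun i hi j hj he => hAinj i hi j hj he), hb]
    have : P ∈ S.image A := by rw [himg]; exact mem_on.mpr ⟨hP, hPL⟩
    obtain ⟨i, hi, he⟩ := Finset.mem_image.mp this
    exact ⟨i, hi, he⟩
  -- the unique node off all maximal lines
  obtain ⟨O, hO⟩ := gc0 (rms_gc' (m := 0) (by omega) h hSm).1.1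
  have hOu : ∀ P ∈ X, (∀ i ∈ S, P ∉ i) → P = O := by
    intro P hP hPi
    have : P ∈ rms X S := mem_rms.mpr ⟨hP, hPi⟩
    rw [hO] at this; simpa using this
  have hO1 : O ∈ X ∧ ∀ i ∈ S, O ∉ i := by
    rw [← mem_rms, hO]; simp
  have hOL : O ∉ L := by
    intro h0
    obtain ⟨i, hi, he⟩ := hsurj O hO1.1 h0
    exact hO1.2 i hi (he ▸ (hA i hi).2.1)
  let R : Set Pt → Set Pt → Prop := fun i j => ∃ g, Ln g ∧ O ∈ g ∧ A i ∈ g ∧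
    ∃ Q ∈ rms X (S.erase j), Q ∈ g ∧ Q ∈ j ∧ Q ≠ A j
  refine tour (R := R) (s := S) (by omega) ?_ ?_
  · intro i hi j hj hij
    have hjS : j ∈ S.erase i := Finset.mem_erase.mpr ⟨hij.symm, hj⟩
    have hcard : ((S.erase i).erase j).card = n - 1 := by
      rw [Finset.card_erase_of_mem hjS, Finset.card_erase_of_mem hi, hb]; omega
    have hsub : ∀ k ∈ (S.erase i).erase j, k ∈ S := fun k hk =>
      Finset.mem_of_mem_erase (Finset.mem_of_mem_erase hk)
    obtain ⟨gW, hW⟩ := rms_gc' (m := 2) (s := (S.erase i).erase j) (by omega) h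
      (fun k hk => hSm k (hsub k hk))
    have iW := hW i (by simp) (hSm i hi)
    have jW := hW j (by simp) (hSm j hj)
    have hAW : ∀ k, k = i ∨ k = j → A k ∈ rms X ((S.erase i).erase j) := by
      intro k hk
      have hkS : k ∈ S := by rcases hk with rfl | rfl <;> assumption
      refine mem_rms.mpr ⟨(hA k hkS).1, fun l hl h0 => ?_⟩
      have := hA' k hkS l (hsub l hl) h0
      subst this
      rcases hk with rfl | rfl <;> simp at hl
    have hoff : ∀ P ∈ rms X ((S.erase i).erase j), P ∉ i → P ∉ j → P = O := by
      intro P hP hPi hPj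
      rw [mem_rms] at hP
      refine hOu P hP.1 fun k hk => ?_
      by_cases h1 : k = i
      · rw [h1]; exact hPi
      by_cases h2 : k = j
      · rw [h2]; exact hPj
      exact hP.2 k (by simp [h1, h2, hk])
    rcases U_b0 gW iW jW hij hL (hAW i (Or.inl rfl)) (hAW j (Or.inr rfl)) (hA i hi).2.1
      (fun h0 => hij (hA' i hi j hj h0)) (hA j hj).2.1 (hA i hi).2.2 (hA j hj).2.2
      (fun P hP h1 h2 => by rw [hoff P hP h1 h2]; exact hOL) with k | k | k
    · exact absurd (rms_ne' (by omega) (fun l hl => (hSm l (hsub l hl)).1) k) hNE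
    · left
      obtain ⟨g, hg, P, hP, hPi, hPj, hPg, hAg, Q, hQ, hQg, hQj, hQi, hQA⟩ := k
      refine ⟨g, hg, by rw [← hoff P hP hPi hPj]; exact hPg, hAg, Q, ?_, hQg, hQj, hQA⟩
      rw [rms_erase (j := i) (Finset.mem_erase.mpr ⟨hij, hi⟩), Finset.erase_right_comm]
      exact mem_rm.mpr ⟨hQ, hQi⟩
    · right
      obtain ⟨g, hg, P, hP, hPi, hPj, hPg, hAg, Q, hQ, hQg, hQj, hQi, hQA⟩ := k
      refine ⟨g, hg, by rw [← hoff P hP hPi hPj]; exact hPg, hAg, Q, ?_, hQg, hQj, hQA⟩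
      rw [rms_erase (j := j) hjS]
      exact mem_rm.mpr ⟨hQ, hQi⟩
  · rintro i hi j hj k hk hik hjk ⟨g, hg, hOg, hAg, Q, hQ, hQg, hQk, hQA⟩
      ⟨g', hg', hOg', hAg', Q', hQ', hQg', hQk', hQA'⟩
    have hcard : (S.erase k).card = n := by rw [Finset.card_erase_of_mem hk, hb]; omega
    obtain ⟨gW, hW⟩ := rms_gc' (m := 1) (s := S.erase k) (by omega) h
      (fun l hl => hSm l (Finset.mem_of_mem_erase hl))
    have kW := hW k (by simp) (hSm k hk)
    have hAW : A k ∈ rms X (S.erase k) := by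
      refine mem_rms.mpr ⟨(hA k hk).1, fun l hl h0 => ?_⟩
      have := hA' k hk l (Finset.mem_of_mem_erase hl) h0
      subst this
      simp at hl
    have hQQ : Q' = Q := by
      rcases two_nodes kW rfl hAW hQ hQ' (hA k hk).2.1 hQk hQk' hQA.symm with h0 | h0
      · exact absurd h0 hQA'
      · exact h0
    subst hQQ
    have hOQ : O ≠ Q' := by rintro rfl; exact hO1.2 k hk hQk
    have := line_eq hg hg' hOQ hOg hQg hOg' hQg'
    subst this
    by_contra hij
    have hAA : A i ≠ A j := fun h0 => hij (hAinj i hi j hj h0)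
    have := line_eq hg hL hAA hAg hAg' (hA i hi).2.2 (hA j hj).2.2
    subst this
    exact hOL hOg

lemma U_n1 {n : ℕ} {X : Finset Pt} (h : G (n + 1) X) {L : Set Pt} (hL : Ln L)
    (hc : ((on X L).card = n + 1 ∧ 4 ≤ n + 1) ∨ ((on X L).card = n ∧ 6 ≤ n + 1))
    (hb : (ML (n + 1) X).card = n) (A : Set Pt → Pt)
    (hA : ∀ i ∈ ML (n + 1) X, A i ∈ X ∧ A i ∈ i ∧ A i ∈ L)
    (hA' : ∀ i ∈ ML (n + 1) X, ∀ j ∈ ML (n + 1) X, A i ∈ j → i = j) : NE (n + 1) X L := by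
  classical
  set S := ML (n + 1) X with hS
  have hSm : ∀ i ∈ S, Mx (n + 1) X i := fun i hi => mem_ML.mp hi
  have hAinj : ∀ i ∈ S, ∀ j ∈ S, A i = A j → i = j := fun i hi j hj he =>
    hA' i hi j hj (he ▸ (hA j hj).2.1)
  have gK : G 1 (rms X S) := (rms_gc' (m := 1) (by omega) h hSm).1
  set K := rms X S with hKdef
  have himg : S.image A ⊆ on X L := by
    intro Q hQ
    obtain ⟨i, hi, rfl⟩ := Finset.mem_image.mp hQ
    exact mem_on.mpr ⟨(hA i hi).1, (hA i hi).2.2⟩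
  have hicard : (S.image A).card = n := by
    rw [Finset.card_image_of_injOn (fun i hi j hj he => hAinj i hi j hj he), hb]
  have hdisj : ∀ P ∈ K, P ∉ S.image A := by
    intro P hP hPA
    obtain ⟨i, hi, rfl⟩ := Finset.mem_image.mp hPA
    exact (mem_rms.mp hP).2 i hi (hA i hi).2.1
  have hKX : ∀ P ∈ K, P ∈ X := fun P hP => (mem_rms.mp hP).1
  -- at most one node of K on L
  have hKL : ∀ P ∈ K, ∀ Q ∈ K, P ∈ L → Q ∈ L → P = Q := by
    intro P hP Q hQ hPL hQL
    by_contra hPQ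
    have hsub : insert P (insert Q (S.image A)) ⊆ on X L := by
      intro R hR
      simp only [Finset.mem_insert] at hR
      rcases hR with rfl | rfl | hR
      · exact mem_on.mpr ⟨hKX _ hP, hPL⟩
      · exact mem_on.mpr ⟨hKX _ hQ, hQL⟩
      · exact himg hR
    have := Finset.card_le_card hsub
    rw [Finset.card_insert_of_notMem, Finset.card_insert_of_notMem (hdisj Q hQ), hicard] at this
    · rcases hc with hc | hc <;> omega
    · simp only [Finset.mem_insert, not_or]
      exact ⟨hPQ, hdisj P hP⟩
  -- sides
  have hsideL : ∀ s, Mx 1 K s → s ≠ L := by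
    rintro s hs rfl
    obtain ⟨P, hP, Q, hQ, hPQ⟩ := Finset.one_lt_card.mp (show 1 < (on K s).card by rw [hs.2]; omega)
    rw [mem_on] at hP hQ
    exact hPQ (hKL P hP.1 Q hQ.1 hP.2 hQ.2)
  let Bd := S.filter (fun i => ∃ s, Mx 1 K s ∧ A i ∈ s)
  have hF3 : (ML 1 K).card ≤ 3 := mu_le (n := 0) gK.1
  have hbd : ∀ i ∈ Bd, ∃ s, Mx 1 K s ∧ A i ∈ s := fun i hi => (Finset.mem_filter.mp hi).2
  have hBS : ∀ i ∈ Bd, i ∈ S := fun i hi => (Finset.mem_filter.mp hi).1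
  choose! f hf1 hf2 using hbd
  have finj : Set.InjOn f (Bd : Finset (Set Pt)) := by
    intro i hi j hj he
    have hi := Finset.mem_coe.mp hi
    have hj := Finset.mem_coe.mp hj
    by_contra hij
    have hAA : A i ≠ A j := fun h0 => hij (hAinj i (hBS i hi) j (hBS j hj) h0)
    exact hsideL _ (hf1 i hi) (line_eq (hf1 i hi).1 hL hAA (hf2 i hi) (by rw [he]; exact hf2 j hj)
      (hA i (hBS i hi)).2.2 (hA j (hBS j hj)).2.2)
  have hgood : 2 ≤ (S \ Bd).card := by
    have hsd : (S \ Bd).card = n - Bd.card := by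
      rw [Finset.card_sdiff_of_subset (Finset.filter_subset _ _), hb]
    rcases hc with ⟨hc1, hc2⟩ | ⟨hc1, hc2⟩
    · -- a node of K on L
      obtain ⟨P, hP, hPn⟩ := Finset.exists_mem_notMem_of_card_lt_card
        (show (S.image A).card < (on X L).card by omega)
      obtain ⟨hPX, hPL⟩ := mem_on.mp hP
      have hPK : P ∈ K := by
        refine mem_rms.mpr ⟨hPX, fun i hi h0 => hPn ?_⟩
        have : P = A i := pt_eq (hSm i hi).1 hL (by
          rintro rfl
          have := (hSm i hi).2
          omega) h0 (hA i hi).2.1 hPL (hA i hi).2.2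
        rw [this]; exact Finset.mem_image_of_mem _ hi
      have hKc : K.card = 3 := gK.1.1.1
      obtain ⟨Q, R, hQR, he⟩ := Finset.card_eq_two.mp
        (show (K.erase P).card = 2 by rw [Finset.card_erase_of_mem hPK]; omega)
      have hQ : Q ∈ K.erase P := by rw [he]; simp
      have hR : R ∈ K.erase P := by rw [he]; simp
      rw [Finset.mem_erase] at hQ hR
      obtain ⟨u, hu, huP, huQ⟩ := exists_line hQ.1.symm
      obtain ⟨v, hv, hvP, hvR⟩ := exists_line hR.1.symm
      have mu' := gc1_line gK.1 hPK hQ.2 hQ.1.symm hu huP huQ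
      have mv' := gc1_line gK.1 hPK hR.2 hR.1.symm hv hvP hvR
      have huv : u ≠ v := by
        rintro rfl
        have := three_le (mem_on.mpr ⟨hPK, huP⟩) (mem_on.mpr ⟨hQ.2, huQ⟩) (mem_on.mpr ⟨hR.2, hvR⟩)
          hQ.1.symm hR.1.symm hQR
        rw [mu'.2] at this; omega
      have hmaps : ∀ i ∈ Bd, f i ∈ ((ML 1 K).erase u).erase v := by
        intro i hi
        have key : P ∉ f i := by
          intro h0
          have hAP : A i ≠ P := by
            rintro rfl
            exact hPn (Finset.mem_image_of_mem _ (hBS i hi))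
          exact hsideL _ (hf1 i hi) (line_eq (hf1 i hi).1 hL hAP (hf2 i hi) h0
            (hA i (hBS i hi)).2.2 hPL)
        refine Finset.mem_erase.mpr ⟨?_, Finset.mem_erase.mpr ⟨?_, mem_ML.mpr (hf1 i hi)⟩⟩
        · intro h0; exact key (h0 ▸ hvP)
        · intro h0; exact key (h0 ▸ huP)
      have h1 := Finset.card_le_card_of_injOn f hmaps finj
      rw [Finset.card_erase_of_mem (Finset.mem_erase.mpr ⟨huv.symm, mem_ML.mpr mv'⟩),
        Finset.card_erase_of_mem (mem_ML.mpr mu')] at h1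
      simp only [Nat.zero_add] at h1
      omega
    · have h1 := Finset.card_le_card_of_injOn (t := ML 1 K) f
        (fun i hi => mem_ML.mpr (hf1 i hi)) finj
      omega
  obtain ⟨i, hi', j, hj', hij⟩ := Finset.one_lt_card.mp hgood
  obtain ⟨hi, hiB⟩ := Finset.mem_sdiff.mp hi'
  obtain ⟨hj, hjB⟩ := Finset.mem_sdiff.mp hj'
  have gi : ∀ s, Mx 1 K s → A i ∉ s := fun s hs h0 => hiB (Finset.mem_filter.mpr ⟨hi, s, hs, h0⟩)
  have gj : ∀ s, Mx 1 K s → A j ∉ s := fun s hs h0 => hjB (Finset.mem_filter.mpr ⟨hj, s, hs, h0⟩)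
  have hjS : j ∈ S.erase i := Finset.mem_erase.mpr ⟨hij.symm, hj⟩
  have hcard : ((S.erase i).erase j).card = n - 2 := by
    rw [Finset.card_erase_of_mem hjS, Finset.card_erase_of_mem hi, hb]; omega
  have hsub : ∀ k ∈ (S.erase i).erase j, k ∈ S := fun k hk =>
    Finset.mem_of_mem_erase (Finset.mem_of_mem_erase hk)
  have hn : n + 1 = 3 + ((S.erase i).erase j).card := by
    rcases hc with hc | hc <;> omega
  obtain ⟨gW, hW⟩ := rms_gc' (m := 3) (s := (S.erase i).erase j) hn h
    (fun k hk => hSm k (hsub k hk))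
  have iW := hW i (by simp) (hSm i hi)
  have jW := hW j (by simp) (hSm j hj)
  have hAW : ∀ k, k = i ∨ k = j → A k ∈ rms X ((S.erase i).erase j) := by
    intro k hk
    have hkS : k ∈ S := by rcases hk with rfl | rfl <;> assumption
    refine mem_rms.mpr ⟨(hA k hkS).1, fun l hl h0 => ?_⟩
    have := hA' k hkS l (hsub l hl) h0
    subst this
    rcases hk with rfl | rfl <;> simp at hl
  have hKe : rm (rm (rms X ((S.erase i).erase j)) i) j = K := by
    rw [rm_comm, ← rms_erase hjS, ← rms_erase hi]
  refine rms_ne' hn (fun l hl => (hSm l (hsub l hl)).1) ?_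
  exact U_b1 gW iW jW hij hL (hAW i (Or.inl rfl)) (hAW j (Or.inr rfl)) (hA i hi).2.1
      (fun h0 => hij (hA' i hi j hj h0)) (hA j hj).2.1 (fun h0 => hij (hA' j hj i hi h0).symm)
      (hA i hi).2.2 (hA j hj).2.2
      (fun s hs => by rw [hKe] at hs; exact ⟨gi s hs, gj s hs⟩)

theorem thmU : ∀ (n : ℕ) (X : Finset Pt) (L : Set Pt), G n X → n ≤ (ML n X).card + 1 → Ln L →
    n + 4 ≤ 2 * (on X L).card → NE n X L := by
  intro n
  induction n using Nat.strong_induction_on with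
  | _ n ih =>
  intro X L h hmu hL hk
  have hle := card_le h.1 hL
  obtain ⟨m, rfl⟩ : ∃ m, n = m + 2 := ⟨n - 2, by omega⟩
  by_cases hmax : Mx (m + 2) X L
  · exact ne_of_mx h.1 hmax
  have hle2 : (on X L).card ≤ m + 2 := by
    by_contra h0
    exact hmax ⟨hL, by omega⟩
  have hneL : ∀ i, Mx (m + 2) X i → i ≠ L := by rintro i hi rfl; exact hmax hi
  by_cases h1 : ∃ i, Mx (m + 2) X i ∧ ¬ ∃ P ∈ X, P ∈ i ∧ P ∈ L
  · obtain ⟨i, hi, hno⟩ := h1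
    rcases card_on_rm (X := X) hi.1 hL (hneL i hi) with ⟨k, -⟩ | ⟨-, k⟩
    · exact absurd k hno
    have := mu_rm h hi
    refine ne_lift hi.1 (ih (m + 1) (by omega) _ L (h.rm hi) (by omega) hL ?_)
    rw [← k]; omega
  push Not at h1
  by_cases h2 : ∃ i j, Mx (m + 2) X i ∧ Mx (m + 2) X j ∧ i ≠ j ∧ ∃ P ∈ X, P ∈ i ∧ P ∈ j ∧ P ∈ L
  · obtain ⟨i, j, hi, hj, hij, P, hP, hPi, hPj, hPL⟩ := h2
    rcases card_on_rm (X := X) hi.1 hL (hneL i hi) with ⟨-, k⟩ | ⟨k, -⟩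
    swap
    · exact absurd ⟨P, hP, hPi, hPL⟩ k
    have hj' := mx_rm h.1 hi hj hij
    rcases card_on_rm (X := rm X i) hj.1 hL (hneL j hj) with ⟨⟨Q, hQ, hQj, hQL⟩, -⟩ | ⟨-, k'⟩
    · have := pt_eq hj.1 hL (hneL j hj) hQj hPj hQL hPL
      subst this
      exact absurd hPi (mem_rm.mp hQ).2
    have m1 := mu_rm h hi
    refine ne_lift hi.1 (ne_lift hj.1 (ih m (by omega) _ L ((h.rm hi).rm hj') ?_ hL ?_))
    · obtain ⟨m', rfl⟩ : ∃ m', m = m' + 1 := ⟨m - 1, by omega⟩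
      have m2 : (ML (m' + 1 + 1) (rm X i)).card ≤ _ := mu_rm (h.rm hi) hj'
      omega
    · rw [← k']; omega
  push Not at h2
  have hex : ∀ i ∈ ML (m + 2) X, ∃ P, P ∈ X ∧ P ∈ i ∧ P ∈ L := by
    intro i hi
    obtain ⟨P, a, b, c⟩ := h1 i (mem_ML.mp hi)
    exact ⟨P, a, b, c⟩
  choose! A hA using hex
  have hA' : ∀ i ∈ ML (m + 2) X, ∀ j ∈ ML (m + 2) X, A i ∈ j → i = j := by
    intro i hi j hj hij
    by_contra hne
    exact h2 i j (mem_ML.mp hi) (mem_ML.mp hj) hne (A i) (hA i hi).1 (hA i hi).2.1 hij (hA i hi).2.2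
  have hAinj : Set.InjOn A (ML (m + 2) X : Finset (Set Pt)) := fun i hi j hj he =>
    hA' i hi j hj (he ▸ (hA j hj).2.1)
  have hbk := Finset.card_le_card_of_injOn (t := on X L) A
    (fun i hi => mem_on.mpr ⟨(hA i hi).1, (hA i hi).2.2⟩) hAinj
  by_cases hb : (ML (m + 2) X).card = m + 2
  · exact U_n h hL (by omega) (by omega) hb A hA hA'
  · exact U_n1 h hL (by omega) (by change (ML (m + 2) X).card = m + 1; omega) A hA hA'


lemma collin {g : Set Pt} (hg : Ln g) {P Q R : Pt} (hP : P ∈ g) (hQ : Q ∈ g) (hR : R ∈ g)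
    {f f' : Poly2} (hf : f.totalDegree = 1) (hf' : f'.totalDegree = 1) (h1 : evalPt f P = 0)
    (h2 : evalPt f' P = 0) : evalPt f Q * evalPt f' R = evalPt f' Q * evalPt f R := by
  obtain ⟨l, hl, rfl⟩ := hg
  obtain ⟨a, b, c, rfl, hab⟩ := linear_form' hl
  obtain ⟨a1, b1, c1, rfl⟩ := linear_form hf.le
  obtain ⟨a2, b2, c2, rfl⟩ := linear_form hf'.le
  simp only [mem_zs, ev_add, ev_mul, ev_C, ev_X0, ev_X1] at *
  have e1 : a * (Q.1 - P.1) + b * (Q.2 - P.2) = 0 := by linarith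
  have e2 : a * (R.1 - P.1) + b * (R.2 - P.2) = 0 := by linarith
  have hdet : (Q.1 - P.1) * (R.2 - P.2) - (R.1 - P.1) * (Q.2 - P.2) = 0 := by
    have k1 : a * ((Q.1 - P.1) * (R.2 - P.2) - (R.1 - P.1) * (Q.2 - P.2)) = 0 := by
      linear_combination (R.2 - P.2) * e1 - (Q.2 - P.2) * e2
    have k2 : b * ((Q.1 - P.1) * (R.2 - P.2) - (R.1 - P.1) * (Q.2 - P.2)) = 0 := by
      linear_combination (Q.1 - P.1) * e2 - (R.1 - P.1) * e1
    rcases mul_eq_zero.mp k1 with ha | h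
    · rcases mul_eq_zero.mp k2 with hb | h
      · exact absurd (by rw [ha, hb]; ring) hab
      · exact h
    · exact h
  have g1 : c1 = -(a1 * P.1 + b1 * P.2) := by linarith
  have g2 : c2 = -(a2 * P.1 + b2 * P.2) := by linarith
  subst g1 g2
  linear_combination (a1 * b2 - a2 * b1) * hdet

lemma span3 {f1 f2 f3 : Poly2} (hf1 : f1.totalDegree = 1) (hf2 : f2.totalDegree = 1)
    (hf3 : f3.totalDegree = 1) {P1 P2 P3 : Pt} (h12 : evalPt f1 P2 = 0) (h13 : evalPt f1 P3 = 0)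
    (h21 : evalPt f2 P1 = 0) (h23 : evalPt f2 P3 = 0) (h31 : evalPt f3 P1 = 0)
    (h32 : evalPt f3 P2 = 0) (h11 : evalPt f1 P1 ≠ 0) (h22 : evalPt f2 P2 ≠ 0)
    (h33 : evalPt f3 P3 ≠ 0) {f : Poly2} (hf : D f 2) :
    f = C (evalPt f P1 / evalPt f1 P1) * f1 + C (evalPt f P2 / evalPt f2 P2) * f2 +
      C (evalPt f P3 / evalPt f3 P3) * f3 := by
  classical
  set r := f - (C (evalPt f P1 / evalPt f1 P1) * f1 + C (evalPt f P2 / evalPt f2 P2) * f2 +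
      C (evalPt f P3 / evalPt f3 P3) * f3) with hr
  have hrD : D r 2 := D_sub hf (D_add (D_add (D_C_mul _ (D_le hf1.le)) (D_C_mul _ (D_le hf2.le)))
    (D_C_mul _ (D_le hf3.le)))
  have r1 : evalPt r P1 = 0 := by
    simp only [hr, ev_sub, ev_add, ev_mul, ev_C, h21, h31]; field_simp; ring
  have r2 : evalPt r P2 = 0 := by
    simp only [hr, ev_sub, ev_add, ev_mul, ev_C, h12, h32]; field_simp; ring
  have r3 : evalPt r P3 = 0 := by
    simp only [hr, ev_sub, ev_add, ev_mul, ev_C, h13, h23]; field_simp; ring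
  have hP : P1 ≠ P2 := by rintro rfl; exact h11 h12
  obtain ⟨q, hq, hD⟩ := dvd_of_vanish hf3 {P1, P2} (by simp [h31, h32]) hrD
    (by rw [Finset.card_pair hP]) (by simp [r1, r2])
  obtain ⟨c, rfl⟩ := D_one hD
  rw [hq, ev_mul, ev_C] at r3
  have hc : c = 0 := (mul_eq_zero.mp r3).resolve_left h33
  rw [hc] at hq
  simp at hq
  exact sub_eq_zero.mp (hr ▸ hq)

lemma alg4 (M : Fin 4 → Fin 4 → ℝ) (hne : ∀ i j, M i j ≠ 0)
    (hrow : ∀ i, M i 0 + M i 1 + M i 2 + M i 3 = 0)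
    (hdet : ∀ i j, M i i * M j j = M i j * M j i) :
    (∃ k : ℝ, ∀ l, M 1 l = k * M 0 l) ∨ (∃ k : ℝ, ∀ l, M 1 l = k * M 2 l) := by
  -- normalised entries
  obtain ⟨H, hH⟩ : ∃ H : Fin 4 → Fin 4 → ℝ, ∀ i j, M i j = M i i * H i j :=
    ⟨fun i j => M i j / M i i, fun i j => by have := hne i i; field_simp⟩
  have h1 : ∀ i, H i i = 1 := fun i => by
    have := hH i i
    have h2 := hne i i
    exact mul_left_cancel₀ h2 (by linarith)
  have h2 : ∀ i j, H i j * H j i = 1 := fun i j => by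
    have e := hdet i j
    have p := mul_ne_zero (hne i i) (hne j j)
    apply mul_left_cancel₀ p
    rw [hH i j, hH j i] at e
    linarith
  have h3 : ∀ i, H i 0 + H i 1 + H i 2 + H i 3 = 0 := fun i => by
    have e := hrow i
    rw [hH i 0, hH i 1, hH i 2, hH i 3] at e
    exact mul_left_cancel₀ (hne i i) (by linarith)
  have r0 := h3 0
  have r1 := h3 1
  have r2 := h3 2
  have r3 := h3 3
  rw [h1] at r0 r1 r2 r3
  have t01 := h2 0 1
  have t02 := h2 0 2
  have t03 := h2 0 3
  have t12 := h2 1 2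
  have t13 := h2 1 3
  have t23 := h2 2 3
  have e1 : H 0 1 * H 1 2 - H 0 2 + (H 0 1 * H 1 3 - H 0 3) = 0 := by
    linear_combination H 0 1 * r1 - r0 - t01
  have e2 : H 0 2 * H 2 3 - H 0 3 = (H 0 1 * H 1 2 - H 0 2) * H 2 1 := by
    linear_combination H 0 2 * r2 - r0 - t02 - H 0 1 * t12
  have e3 : (H 0 1 * H 1 2 - H 0 2) * (H 3 1 - H 3 2 * H 2 1) = 0 := by
    linear_combination H 0 3 * r3 - r0 - t03 + H 3 1 * e1 - H 0 1 * t13 - H 0 2 * t23 + H 3 2 * e2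
  rcases mul_eq_zero.mp e3 with x | x
  · left
    refine ⟨M 1 1 * H 1 0 / M 0 0, fun l => ?_⟩
    have n0 := hne 0 0
    rw [hH 1 l, hH 0 l]
    have key : H 1 l = H 1 0 * H 0 l := by
      fin_cases l
      · simp [h1]
      · simp only [Fin.mk_one, h1]; linarith
      · change H 1 2 = H 1 0 * H 0 2
        linear_combination H 1 0 * x - H 1 2 * t01
      · change H 1 3 = H 1 0 * H 0 3
        linear_combination H 1 0 * (e1 - x) - H 1 3 * t01
    rw [key]; field_simp
  · right
    refine ⟨M 1 1 * H 1 2 / M 2 2, fun l => ?_⟩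
    have n0 := hne 2 2
    rw [hH 1 l, hH 2 l]
    have k3 : H 1 3 = H 1 2 * H 2 3 := by
      linear_combination (H 1 2 * H 2 3) * t13 - H 1 3 * H 1 2 * H 2 3 * x -
        H 1 3 * (H 2 1 * H 1 2 * t23 + t12)
    have key : H 1 l = H 1 2 * H 2 l := by
      fin_cases l
      · change H 1 0 = H 1 2 * H 2 0
        linear_combination r1 - H 1 2 * r2 - k3 + t12
      · change H 1 1 = H 1 2 * H 2 1
        rw [h1, t12]
      · change H 1 2 = H 1 2 * H 2 2
        rw [h1, mul_one]
      · exact k3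
    rw [key]; field_simp


lemma uniq0 {X : Finset Pt} (h : IsGC 0 X) {P Q : Pt} (hP : P ∈ X) (hQ : Q ∈ X) : P = Q := by
  obtain ⟨A, rfl⟩ := gc0 h
  rw [Finset.mem_singleton] at hP hQ
  rw [hP, hQ]

lemma pairA {Y : Finset Pt} (h : G 4 Y) {a b : Set Pt} (ha : Mx 4 Y a) (hb : Mx 4 Y b) (hab : a ≠ b)
    {mi mj mk ml : Set Pt} (hij : mi ≠ mj) (hik : mi ≠ mk) (hil : mi ≠ ml) (hjk : mj ≠ mk)
    (hjl : mj ≠ ml) (hkl : mk ≠ ml)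
    (ik : Mx 3 (rm Y b) mk) (il : Mx 3 (rm Y b) ml) (ij : Mx 3 (rm Y b) mj)
    (jk : Mx 3 (rm Y a) mk) (jl : Mx 3 (rm Y a) ml) (ji : Mx 3 (rm Y a) mi)
    (ki : Mx 2 (rm (rm Y a) b) mi) (kj : Mx 2 (rm (rm Y a) b) mj)
    (ii : ¬ Mx 3 (rm Y b) mi) (jj : ¬ Mx 3 (rm Y a) mj) {Bi Bj : Pt}
    (hBi : Bi ∈ rm (rm (rm (rm Y b) mk) ml) mj) (hBj : Bj ∈ rm (rm (rm (rm Y a) mk) ml) mi) :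
    ∃ g, Ln g ∧ ∃ O, O ∈ mi ∧ O ∈ mj ∧ O ∈ g ∧ Bi ∈ g ∧ Bj ∈ g := by
  have hk := up2 h ha hb hab jk ik
  have hl := up2 h ha hb hab jl il
  have hZa := h.rm hb
  have hZb := h.rm ha
  have hbZ := mx_rm h.1 ha hb hab
  have haZ := mx_rm h.1 hb ha hab.symm
  have hK := hZb.rm hbZ
  have kk : Mx 2 (rm (rm Y a) b) mk := mx_rm hZb.1 hbZ jk (rm_ne ik)
  have kl : Mx 2 (rm (rm Y a) b) ml := mx_rm hZb.1 hbZ jl (rm_ne il)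
  have hYk := h.rm hk
  have hl' := mx_rm h.1 hk hl hkl
  have hW := hYk.rm hl'
  have aW := mx_rm hYk.1 hl' (mx_rm h.1 hk ha (rm_ne jk).symm) (rm_ne jl).symm
  have bW := mx_rm hYk.1 hl' (mx_rm h.1 hk hb (rm_ne ik).symm) (rm_ne il).symm
  obtain ⟨g, O, hO, P, hP, Q, hQ, hg, hga, hgb, Og, Oa, Ob, Pg, Pa, Pb, Qg, Qa, Qb⟩ := tri hW aW bW hab
  simp only [mem_rm] at hO hP hQ
  -- the node of K off mk, ml
  obtain ⟨O', hO', O'i, O'j⟩ := mx_meet hK.1 ki kj hij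
  have hK0 : IsGC 0 (rm (rm (rm (rm Y a) b) mk) ml) :=
    rm_gc (rm_gc hK.1 kk) (mx_rm hK.1 kk kl hkl)
  have hOO : O = O' := by
    apply uniq0 hK0
    · simp only [mem_rm]; tauto
    · have e1 : O' ∉ mk := fun e => no_three hK.1 ki kj kk hij hik hjk O'i O'j e
      have e2 : O' ∉ ml := fun e => no_three hK.1 ki kj kl hij hil hjl O'i O'j e
      simp only [mem_rm] at hO' ⊢; tauto
  subst hOO
  have hOP : O ≠ P := by rintro rfl; exact Oa Pa
  have hOQ : O ≠ Q := by rintro rfl; exact Ob Qb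
  have Pj : P ∉ mj := by
    intro e
    have := line_eq kj.1 hg.1 hOP O'j e Og Pg
    subst this
    exact jj (mx_up hZb.1 hb.1 kj ⟨Q, by simp only [mem_rm]; tauto, Qb, Qg⟩)
  have Qi : Q ∉ mi := by
    intro e
    have := line_eq ki.1 hg.1 hOQ O'i e Og Qg
    subst this
    refine ii (mx_up hZa.1 ha.1 (by rw [rm_comm]; exact ki) ⟨P, by simp only [mem_rm]; tauto, Pa, Pg⟩)
  have hPB : P = Bi := by
    have h1 := hZa.rm ik
    have h2 := mx_rm hZa.1 ik il hkl
    refine uniq0 (rm_gc (rm_gc h1.1 h2) (mx_rm h1.1 h2 (mx_rm hZa.1 ik ij hjk.symm) hjl.symm)) ?_ hBi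
    simp only [mem_rm]; tauto
  have hQB : Q = Bj := by
    have h1 := hZb.rm jk
    have h2 := mx_rm hZb.1 jk jl hkl
    refine uniq0 (rm_gc (rm_gc h1.1 h2) (mx_rm h1.1 h2 (mx_rm hZb.1 jk ji hik.symm) hil.symm)) ?_ hBj
    simp only [mem_rm]; tauto
  subst hPB hQB
  exact ⟨g, hg.1, O, O'i, O'j, Og, Pg, Qg⟩

lemma caseA {K : Finset Pt} (hK : G 2 K) (m : Fin 4 → Set Pt) (B : Fin 4 → Pt)
    (hm : ∀ i, Mx 2 K (m i)) (hinj : ∀ i j, i ≠ j → m i ≠ m j) (hB : ∀ i j, B i ∉ m j)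
    (hBne : ∀ i j, i ≠ j → B i ≠ B j)
    (hp : ∀ i j, i ≠ j → ∃ g, Ln g ∧ ∃ O, O ∈ m i ∧ O ∈ m j ∧ O ∈ g ∧ B i ∈ g ∧ B j ∈ g) : False := by
  choose f hf hmf using fun i => (hm i).1
  have hz : ∀ i P, P ∈ m i ↔ evalPt (f i) P = 0 := fun i P => by rw [hmf i]; rfl
  have pt : ∀ i j k, i ≠ j → i ≠ k → j ≠ k → ∃ P, evalPt (f i) P = 0 ∧ evalPt (f j) P = 0 ∧
      evalPt (f k) P ≠ 0 := by
    intro i j k h1 h2 h3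
    obtain ⟨P, -, hi, hj⟩ := mx_meet hK.1 (hm i) (hm j) (hinj _ _ h1)
    refine ⟨P, (hz _ _).1 hi, (hz _ _).1 hj, fun e => ?_⟩
    exact no_three hK.1 (hm i) (hm j) (hm k) (hinj _ _ h1) (hinj _ _ h2) (hinj _ _ h3) hi hj
      ((hz _ _).2 e)
  obtain ⟨P1, h21, h31, h11⟩ := pt 1 2 0 (by decide) (by decide) (by decide)
  obtain ⟨P2, h12, h32, h22⟩ := pt 0 2 1 (by decide) (by decide) (by decide)
  obtain ⟨P3, h13, h23, h33⟩ := pt 0 1 2 (by decide) (by decide) (by decide)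
  have n3 : ∀ i j P, i ≠ j → i ≠ 3 → j ≠ 3 → evalPt (f i) P = 0 → evalPt (f j) P = 0 →
      evalPt (f 3) P ≠ 0 := by
    intro i j P h1 h2 h3 e1 e2 e3
    exact no_three hK.1 (hm i) (hm j) (hm 3) (hinj _ _ h1) (hinj _ _ h2) (hinj _ _ h3)
      ((hz _ _).2 e1) ((hz _ _).2 e2) ((hz _ _).2 e3)
  have c1 := n3 1 2 P1 (by decide) (by decide) (by decide) h21 h31
  have c2 := n3 0 2 P2 (by decide) (by decide) (by decide) h12 h32
  have c3 := n3 0 1 P3 (by decide) (by decide) (by decide) h13 h23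
  have sp : ∀ q : Poly2, D q 2 → ∃ a b c : ℝ, ∀ P, evalPt q P =
      a * evalPt (f 0) P + b * evalPt (f 1) P + c * evalPt (f 2) P := fun q hq => by
    refine ⟨evalPt q P1 / evalPt (f 0) P1, evalPt q P2 / evalPt (f 1) P2,
      evalPt q P3 / evalPt (f 2) P3, fun P => ?_⟩
    have e := congrArg (fun r => evalPt r P)
      (span3 (hf 0) (hf 1) (hf 2) h12 h13 h21 h23 h31 h32 h11 h22 h33 hq)
    simpa only [ev_add, ev_mul, ev_C] using e
  obtain ⟨a, b, c, habc⟩ := sp (f 3) (D_le (hf 3).le)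
  have ha : a ≠ 0 := by
    rintro rfl; apply c1; rw [habc, h21, h31]; ring
  have hb : b ≠ 0 := by
    rintro rfl; apply c2; rw [habc, h12, h32]; ring
  have hc : c ≠ 0 := by
    rintro rfl; apply c3; rw [habc, h13, h23]; ring
  let w : Fin 4 → ℝ := ![a, b, c, -1]
  have hw : ∀ i, w i ≠ 0 := by
    intro i; fin_cases i <;> simp [w, ha, hb, hc]
  have key : ∀ i j, i ≠ j → ∀ k : ℝ, (∀ l, w l * evalPt (f l) (B i) = k * (w l * evalPt (f l) (B j))) →
      False := by
    intro i j hij k hk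
    have hk' : ∀ l, evalPt (f l) (B i) = k * evalPt (f l) (B j) := fun l =>
      mul_left_cancel₀ (hw l) (by rw [hk l]; ring)
    have hall : ∀ q : Poly2, D q 2 → evalPt q (B i) = k * evalPt q (B j) := by
      intro q hq
      obtain ⟨x, y, z, e⟩ := sp q hq
      rw [e, e, hk', hk', hk']; ring
    have e1 := hall (C 1) (D_le (by rw [totalDegree_C]; omega))
    have e2 := hall (X 0) (D_le (by rw [totalDegree_X]))
    have e3 := hall (X 1) (D_le (by rw [totalDegree_X]))
    simp only [ev_C, ev_X0, ev_X1] at e1 e2 e3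
    have : k = 1 := by linarith
    subst this
    exact hBne i j hij (Prod.ext (by linarith) (by linarith))
  rcases alg4 (fun i l => w l * evalPt (f l) (B i))
    (fun i l => mul_ne_zero (hw l) (fun e => hB i l ((hz _ _).2 e)))
    (fun i => by simp [w, habc]; )
    (fun i j => by
      by_cases hij : i = j
      · subst hij; rfl
      obtain ⟨g, hg, O, O1, O2, Og, h1, h2⟩ := hp i j hij
      have := collin hg Og h1 h2 (hf i) (hf j) ((hz _ _).1 O1) ((hz _ _).1 O2)
      linear_combination w i * w j * this) with ⟨k, hk⟩ | ⟨k, hk⟩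
  · exact key 1 0 (by decide) k hk
  · exact key 1 2 (by decide) k hk


structure Tri (K : Finset Pt) (m w : Fin 3 → Set Pt) (Q : Fin 3 → Pt) : Prop where
  M : ∀ i, Mx 2 K (m i)
  inj : ∀ i j, i ≠ j → m i ≠ m j
  QK : ∀ i, Q i ∈ K
  Qm : ∀ i, Q i ∈ m i
  Qn : ∀ i j, i ≠ j → Q i ∉ m j
  W : ∀ i, Mx 1 (rm K (m i)) (w i)
  Qw : ∀ i j, i ≠ j → Q j ∈ w i
  wm : ∀ i j, w i ≠ m j
  ww : ∀ i j, i ≠ j → w i ≠ w j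

lemma third3 : ∀ i j : Fin 3, i ≠ j → ∃ k, k ≠ i ∧ k ≠ j := by decide

lemma two3 : ∀ i : Fin 3, ∃ j k, j ≠ i ∧ k ≠ i ∧ j ≠ k := by decide

lemma tri_mk {K : Finset Pt} (hK : G 2 K) (m : Fin 3 → Set Pt) (hM : ∀ i, Mx 2 K (m i))
    (inj : ∀ i j, i ≠ j → m i ≠ m j) (hall : ∀ s, Mx 2 K s → ∃ i, s = m i) :
    ∃ w Q, Tri K m w Q := by
  classical
  have hQ : ∀ i, ∃ Q ∈ K, Q ∈ m i ∧ ∀ j, i ≠ j → Q ∉ m j := by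
    intro i
    obtain ⟨j, k, hj, hk, hjk⟩ := two3 i
    have h1 := hK.rm (hM j)
    have hkj := mx_rm hK.1 (hM j) (hM k) (inj _ _ hjk)
    have hij := mx_rm hK.1 (hM j) (hM i) (inj _ _ hj)
    have hi := mx_rm h1.1 hkj hij (inj _ _ hk)
    have h2 := hi.2
    obtain ⟨Q, hQ⟩ := Finset.card_pos.mp (by rw [h2]; omega)
    simp only [mem_on, mem_rm] at hQ
    refine ⟨Q, hQ.1.1.1, hQ.2, fun l hl => ?_⟩
    have : l = j ∨ l = k := by omega
    rcases this with rfl | rfl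
    · exact hQ.1.1.2
    · exact hQ.1.2
  choose Q QK Qm Qn using hQ
  have Qne : ∀ i j, i ≠ j → Q i ≠ Q j := fun i j hij e => Qn i j hij (by rw [e]; exact Qm j)
  have hw : ∀ i, ∃ w, Ln w ∧ ∀ j, i ≠ j → Q j ∈ w := by
    intro i
    obtain ⟨j, k, hj, hk, hjk⟩ := two3 i
    obtain ⟨w, hw, h1, h2⟩ := exists_line (Qne j k hjk)
    refine ⟨w, hw, fun l hl => ?_⟩
    have : l = j ∨ l = k := by omega
    rcases this with rfl | rfl
    · exact h1
    · exact h2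
  choose w wL Qw using hw
  have wm : ∀ i j, w i ≠ m j := by
    intro i j e
    by_cases hij : i = j
    · subst hij
      obtain ⟨j, k, hj, hk, hjk⟩ := two3 i
      exact Qn j i hj (by rw [← e]; exact Qw i j hj.symm)
    · obtain ⟨k, hi, hj⟩ := third3 i j hij
      exact Qn k j hj (by rw [← e]; exact Qw i k hi.symm)
  refine ⟨w, Q, hM, inj, QK, Qm, Qn, fun i => ?_, Qw, wm, fun i j hij e => ?_⟩
  · obtain ⟨j, k, hj, hk, hjk⟩ := two3 i
    exact gc1_line (hK.rm (hM i)).1 (by simp [QK, Qn _ _ hj]) (by simp [QK, Qn _ _ hk]) (Qne j k hjk) (wL i)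
      (Qw i j hj.symm) (Qw i k hk.symm)
  · have hin : ∀ l, Q l ∈ w i := fun l => by
      by_cases h : i = l
      · subst h; rw [e]; exact Qw _ _ hij.symm
      · exact Qw _ _ h
    have : Mx 2 K (w i) := by
      refine ⟨wL i, le_antisymm (card_le hK.1 (wL i)) ?_⟩
      exact three_le (a := Q 0) (b := Q 1) (c := Q 2) (by simp [QK, hin]) (by simp [QK, hin])
        (by simp [QK, hin]) (Qne _ _ (by decide)) (Qne _ _ (by decide)) (Qne _ _ (by decide))
    obtain ⟨l, hl⟩ := hall _ this
    exact wm _ _ hl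

lemma wh {Z : Finset Pt} (h : G 3 Z) {a m m' w : Set Pt} (ha : Mx 3 Z a) (hm : Mx 3 Z m)
    (hma : m ≠ a) (hm' : Mx 2 (rm Z a) m') (hmm : m ≠ m') (hn : ¬ Mx 3 Z m')
    (hw : Mx 1 (rm (rm Z a) m) w) (hwm : w ≠ m') : Mx 2 (rm Z m) w := by
  have hg := h.rm hm
  have ha' := mx_rm h.1 hm ha hma
  have hmK := mx_rm h.1 ha hm hma.symm
  have h1 : Mx 1 (rm (rm Z m) a) m' := by
    rw [rm_comm]; exact mx_rm (h.rm ha).1 hmK hm' hmm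
  rcases lemM hg ha' (by rw [rm_comm]; exact hw) h1 hwm with h2 | h2
  · exact h2
  · exfalso
    obtain ⟨P, hP, hPa, hPm⟩ := mx_meet hg.1 ha' h2 (rm_ne hm')
    exact hn (mx_up h.1 ha.1 hm' ⟨P, (mem_rm.mp hP).1, hPa, hPm⟩)

lemma pairB1 {Y : Finset Pt} (h : G 4 Y) {a c : Set Pt} (ha : Mx 4 Y a) (hc : Mx 4 Y c) (hac : a ≠ c)
    {m w : Fin 3 → Set Pt} {Q : Fin 3 → Pt} (T : Tri (rm (rm Y a) c) m w Q) {i j k : Fin 3}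
    (hij : i ≠ j) (hik : i ≠ k) (hjk : j ≠ k)
    (aj : Mx 3 (rm Y c) (m j)) (ak : Mx 3 (rm Y c) (m k)) (ai : ¬ Mx 3 (rm Y c) (m i))
    (ci : Mx 3 (rm Y a) (m i)) (cj : Mx 3 (rm Y a) (m j)) (ck : ¬ Mx 3 (rm Y a) (m k))
    {O P : Pt} (hO : O ∈ rm (rm Y a) c) (Oi : O ∈ m i) (Ok : O ∈ m k)
    (hP : P ∈ rm (rm (rm (rm Y c) (m j)) (w j)) (m k)) :
    ∃ g, Ln g ∧ O ∈ g ∧ P ∈ g ∧ P ≠ O ∧ ∃ R ∈ rm Y a, R ∈ g ∧ R ∈ w i ∧ R ∈ c := by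
  have hj := up2 h ha hc hac cj aj
  have hZa := h.rm hc
  have hZc := h.rm ha
  have cZ := mx_rm h.1 ha hc hac
  have aZ := mx_rm h.1 hc ha hac.symm
  have hK := hZc.rm cZ
  have eK : rm (rm Y c) a = rm (rm Y a) c := rm_comm _ _ _
  have waj : Mx 2 (rm (rm Y c) (m j)) (w j) := wh hZa aZ aj (rm_ne cj).symm (by rw [eK]; exact T.M i)
    (T.inj _ _ hij.symm) ai (by rw [eK]; exact T.W j) (T.wm _ _)
  have wcj : Mx 2 (rm (rm Y a) (m j)) (w j) := wh hZc cZ cj (rm_ne aj).symm (T.M k)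
    (T.inj _ _ hjk) ck (T.W j) (T.wm _ _)
  have wci : Mx 2 (rm (rm Y a) (m i)) (w i) := wh hZc cZ ci (rm_ne (T.M i)).symm (T.M k)
    (T.inj _ _ hik) ck (T.W i) (T.wm _ _)
  have hYj := h.rm hj
  have aYj := mx_rm h.1 hj ha (rm_ne cj).symm
  have cYj := mx_rm h.1 hj hc (rm_ne aj).symm
  have wYj : Mx 3 (rm Y (m j)) (w j) := up2 hYj aYj cYj hac (by rw [rm_comm]; exact wcj)
    (by rw [rm_comm]; exact waj)
  have neaw : w j ≠ a := by
    intro e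
    exact rm_ne (X := rm Y (m j)) (M := w j) (by rw [rm_comm]; exact wcj) e.symm
  have necw : w j ≠ c := by
    intro e
    exact rm_ne (X := rm Y (m j)) (M := w j) (by rw [rm_comm]; exact waj) e.symm
  have hW := hYj.rm wYj
  have aW := mx_rm hYj.1 wYj aYj neaw
  have cW := mx_rm hYj.1 wYj cYj necw
  obtain ⟨g, O', hO', P', hP', R, hR, hg, hga, hgc, Og, Oa, Oc, Pg, Pa, Pc, Rg, Ra, Rc⟩ := tri hW aW cW hac
  simp only [mem_rm] at hO' hP' hR
  have hOO : O' = O := by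
    apply uniq0 (rm_gc (hK.rm (T.M j)).1 (T.W j))
    · simp only [mem_rm]; tauto
    · have e1 : O ∉ m j := fun e => no_three hK.1 (T.M i) (T.M k) (T.M j) (T.inj _ _ hik)
        (T.inj _ _ hij) (T.inj _ _ hjk.symm) Oi Ok e
      have e2 : O ∉ w j := fun e => no_three (hK.rm (T.M j)).1
        (mx_rm hK.1 (T.M j) (T.M i) (T.inj _ _ hij.symm))
        (mx_rm hK.1 (T.M j) (T.M k) (T.inj _ _ hjk)) (T.W j) (T.inj _ _ hik) (T.wm _ _).symm
        (T.wm _ _).symm Oi Ok e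
      simp only [mem_rm] at hO ⊢; tauto
  subst hOO
  have hOP : O' ≠ P' := by rintro rfl; exact Oa Pa
  have hOR : O' ≠ R := by rintro rfl; exact Oc Rc
  have Pk : P' ∉ m k := by
    intro e
    have e2 := line_eq (T.M k).1 hg.1 hOP Ok e Og Pg
    exact ck (mx_up hZc.1 hc.1 (T.M k) ⟨R, by simp only [mem_rm]; tauto, Rc, by rw [e2]; exact Rg⟩)
  have Ri : R ∉ m i := by
    intro e
    have e2 := line_eq (T.M i).1 hg.1 hOR Oi e Og Rg
    exact ai (mx_up hZa.1 ha.1 (by rw [eK]; exact T.M i)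
      ⟨P', by simp only [mem_rm]; tauto, Pa, by rw [e2]; exact Pg⟩)
  have hPP : P' = P := by
    have h1 := hZa.rm aj
    refine uniq0 (rm_gc (rm_gc h1.1 waj) (mx_rm h1.1 waj (mx_rm hZa.1 aj ak (T.inj _ _ hjk)) (T.wm _ _))) ?_ hP
    simp only [mem_rm]; tauto
  subst hPP
  refine ⟨g, hg.1, Og, Pg, hOP.symm, R, by simp only [mem_rm]; tauto, Rg, ?_, Rc⟩
  by_contra Rw
  have h1 := hZc.rm ci
  have h1' := hZc.rm cj
  obtain ⟨S, hS, Sc, Sw⟩ := mx_meet h1'.1 (mx_rm hZc.1 cj cZ (rm_ne aj).symm) wcj necw.symm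
  have Si : S ∉ m i := fun e => no_three h1'.1 (mx_rm hZc.1 cj cZ (rm_ne aj).symm) wcj
    (mx_rm hZc.1 cj ci (T.inj _ _ hij.symm)) necw.symm (rm_ne (T.M i)) (T.wm _ _) Sc Sw e
  have Swi : S ∉ w i := by
    intro e
    have := pt_eq wci.1 wcj.1 (T.ww _ _ hij) e (T.Qw i k hik) Sw (T.Qw j k hjk)
    subst this
    have := T.QK k
    simp only [mem_rm] at this
    exact this.2 Sc
  have : R = S := by
    have h2 := mx_rm hZc.1 ci cj (T.inj _ _ hij)
    refine uniq0 (rm_gc (h1.rm wci).1 (mx_rm h1.1 wci h2 (T.wm _ _))) ?_ ?_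
    · simp only [mem_rm]; tauto
    · simp only [mem_rm] at hS ⊢; tauto
  subst this
  exact hR.2 Sw

lemma pairB2 {Y : Finset Pt} (h : G 4 Y) {a d : Set Pt} (ha : Mx 4 Y a) (hd : Mx 4 Y d) (had : a ≠ d)
    {m w : Fin 3 → Set Pt} {Q : Fin 3 → Pt} (T : Tri (rm (rm Y a) d) m w Q) {i j k : Fin 3}
    (hij : i ≠ j) (hik : i ≠ k) (hjk : j ≠ k)
    (aj : Mx 3 (rm Y d) (m j)) (ak : Mx 3 (rm Y d) (m k)) (ai : ¬ Mx 3 (rm Y d) (m i))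
    (di : Mx 3 (rm Y a) (m i)) (dj : Mx 3 (rm Y a) (m j)) (dk : Mx 3 (rm Y a) (m k))
    {B : Pt} (hB : B ∈ rm Y a) (hBm : ∀ i, B ∉ m i) :
    B ∈ d ∧ (B ∈ w j ∨ B ∈ w k) := by
  have hj := up2 h ha hd had dj aj
  have hk := up2 h ha hd had dk ak
  have hZa := h.rm hd
  have hZd := h.rm ha
  have dZ := mx_rm h.1 ha hd had
  have aZ := mx_rm h.1 hd ha had.symm
  have hK := hZd.rm dZ
  have eK : rm (rm Y d) a = rm (rm Y a) d := rm_comm _ _ _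
  have waj : Mx 2 (rm (rm Y d) (m j)) (w j) := wh hZa aZ aj (rm_ne dj).symm (by rw [eK]; exact T.M i)
    (T.inj _ _ hij.symm) ai (by rw [eK]; exact T.W j) (T.wm _ _)
  have wak : Mx 2 (rm (rm Y d) (m k)) (w k) := wh hZa aZ ak (rm_ne dk).symm (by rw [eK]; exact T.M i)
    (T.inj _ _ hik.symm) ai (by rw [eK]; exact T.W k) (T.wm _ _)
  have hYj := h.rm hj
  have aYj := mx_rm h.1 hj ha (rm_ne dj).symm
  have dYj := mx_rm h.1 hj hd (rm_ne aj).symm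
  have kYj := mx_rm h.1 hj hk (T.inj _ _ hjk)
  have hW := hYj.rm kYj
  have aW := mx_rm hYj.1 kYj aYj (rm_ne dk).symm
  have dW := mx_rm hYj.1 kYj dYj (rm_ne ak).symm
  obtain ⟨g, O, hO, P, hP, R, hR, hg, hga, hgd, Og, Oa, Od, Pg, Pa, Pd, Rg, Ra, Rd⟩ := tri hW aW dW had
  simp only [mem_rm] at hO hP hR
  have hOQ : O = Q i := by
    apply uniq0 (rm_gc (hK.rm (T.M j)).1 (mx_rm hK.1 (T.M j) (T.M k) (T.inj _ _ hjk)))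
    · simp only [mem_rm]; tauto
    · have := T.QK i
      have := T.Qn i j hij
      have := T.Qn i k hik
      simp only [mem_rm] at *; tauto
  subst hOQ
  have hOP : Q i ≠ P := by rintro e; rw [e] at Oa; exact Oa Pa
  have hOR : Q i ≠ R := by rintro e; rw [e] at Od; exact Od Rd
  have Ri : R ∉ m i := by
    intro e
    have e2 := line_eq (T.M i).1 hg.1 hOR (T.Qm i) e Og Rg
    exact ai (mx_up hZa.1 ha.1 (by rw [eK]; exact T.M i)
      ⟨P, by simp only [mem_rm]; tauto, Pa, by rw [e2]; exact Pg⟩)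
  have hRB : R = B := by
    have h1 := hZd.rm di
    have h2 := mx_rm hZd.1 di dj (T.inj _ _ hij)
    refine uniq0 (rm_gc (h1.rm h2).1 (mx_rm h1.1 h2 (mx_rm hZd.1 di dk (T.inj _ _ hik)) (T.inj _ _ hjk))) ?_ ?_
    · simp only [mem_rm]; tauto
    · have := hBm i
      have := hBm j
      have := hBm k
      simp only [mem_rm] at *; tauto
  subst hRB
  refine ⟨Rd, ?_⟩
  by_cases Pj : P ∈ w j
  · left
    rw [line_eq (T.W j).1 hg.1 hOP (T.Qw _ _ hij.symm) Pj Og Pg]; exact Rg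
  right
  have Pk : P ∈ w k := by
    have h1 := hZa.rm aj
    have h1' := hZa.rm ak
    have aZk := mx_rm hZa.1 ak aZ (rm_ne dk).symm
    have neaw : a ≠ w k := rm_ne (X := rm (rm Y d) (m k)) (M := w k) (n := 1)
      (by rw [rm_comm, eK]; exact T.W k)
    obtain ⟨S, hS, Sa, Sw⟩ := mx_meet h1'.1 aZk wak neaw
    have Sj : S ∉ m j := fun e => no_three h1'.1 aZk wak
      (mx_rm hZa.1 ak aj (T.inj _ _ hjk.symm)) neaw (rm_ne dj) (T.wm _ _) Sa Sw e
    have Swj : S ∉ w j := by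
      intro e
      have e2 := pt_eq waj.1 wak.1 (T.ww _ _ hjk) e (T.Qw j i hij.symm) Sw (T.Qw k i hik.symm)
      rw [e2] at Sa
      exact Oa Sa
    have : P = S := by
      have h2 := mx_rm hZa.1 aj ak (T.inj _ _ hjk)
      refine uniq0 (rm_gc (h1.rm waj).1 (mx_rm h1.1 waj h2 (T.wm _ _))) ?_ ?_
      · simp only [mem_rm]; tauto
      · simp only [mem_rm] at hS ⊢; tauto
    rw [this]; exact Sw
  rw [line_eq (T.W k).1 hg.1 hOP (T.Qw _ _ hik.symm) Pk Og Pg]; exact Rg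


section
open Classical

/-- the line `m` stays maximal when the line `l` is put back -/
def Hit (r : ℕ) (X : Finset Pt) (S : Finset (Set Pt)) (m l : Set Pt) : Prop :=
  Mx (r + 1) (rms X (S.erase l)) m

/-- setup: `S` consists of maximal lines of `X` -/
def St (n r : ℕ) (X : Finset Pt) (S : Finset (Set Pt)) : Prop :=
  n = r + S.card ∧ G n X ∧ ∀ L ∈ S, Mx n X L

lemma St.K {n r : ℕ} {X : Finset Pt} {S : Finset (Set Pt)} (h : St n r X S) : G r (rms X S) :=
  (rms_gc' h.1 h.2.1 h.2.2).1

lemma St.Z {n r : ℕ} {X : Finset Pt} {S : Finset (Set Pt)} (h : St n r X S) {a : Set Pt} (ha : a ∈ S) :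
    G (r + 1) (rms X (S.erase a)) ∧ Mx (r + 1) (rms X (S.erase a)) a ∧
      rm (rms X (S.erase a)) a = rms X S := by
  have hc := Finset.card_erase_add_one ha
  have := rms_gc' (s := S.erase a) (m := r + 1) (by have := h.1; omega) h.2.1
    (fun L hL => h.2.2 L (Finset.mem_of_mem_erase hL))
  exact ⟨this.1, this.2 a (by simp) (h.2.2 a ha), (rms_erase ha).symm⟩

lemma St.Y {n r : ℕ} {X : Finset Pt} {S : Finset (Set Pt)} (h : St n r X S) {a c : Set Pt} (ha : a ∈ S)
    (hc : c ∈ S) (hac : a ≠ c) : ∃ Y, G (r + 2) Y ∧ Mx (r + 2) Y a ∧ Mx (r + 2) Y c ∧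
      rm Y c = rms X (S.erase a) ∧ rm Y a = rms X (S.erase c) ∧ rm (rm Y a) c = rms X S := by
  have hc1 := Finset.card_erase_add_one ha
  have hc' : c ∈ S.erase a := by simp [hc, hac.symm]
  have ha' : a ∈ S.erase c := by simp [ha, hac]
  have hc2 := Finset.card_erase_add_one hc'
  have := rms_gc' (s := (S.erase a).erase c) (m := r + 2) (by have := h.1; omega) h.2.1
    (fun L hL => h.2.2 L (Finset.mem_of_mem_erase (Finset.mem_of_mem_erase hL)))
  have e2 : rm (rms X ((S.erase a).erase c)) a = rms X (S.erase c) := by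
    rw [Finset.erase_right_comm]; exact (rms_erase ha').symm
  refine ⟨_, this.1, this.2 a (by simp) (h.2.2 a ha), this.2 c (by simp) (h.2.2 c hc),
    (rms_erase hc').symm, e2, ?_⟩
  rw [e2]; exact (rms_erase hc).symm

lemma not_mem_S {r : ℕ} {X : Finset Pt} {S : Finset (Set Pt)} {m : Set Pt} (hm : Mx r (rms X S) m) :
    m ∉ S := by
  intro h
  obtain ⟨A, hA⟩ := Finset.card_pos.mp (by rw [hm.2]; omega : 0 < (on (rms X S) m).card)
  simp only [mem_on, mem_rms] at hA
  exact hA.1.2 m h hA.2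

lemma upAll {n r : ℕ} {X : Finset Pt} {S : Finset (Set Pt)} (h : St n r X S) {m : Set Pt}
    (hm : Mx r (rms X S) m) (t : Finset (Set Pt)) (htS : t ⊆ S) (ht : ∀ l ∈ t, Hit r X S m l) :
    Mx (r + t.card) (rms X (S \ t)) m := by
  induction t using Finset.induction_on with
  | empty => simpa using hm
  | insert a t hat ih =>
    have haS : a ∈ S := htS (by simp)
    have ih' := ih (fun x hx => htS (by simp [hx])) (fun l hl => ht l (by simp [hl]))
    have e1 : S \ t = insert a (S \ insert a t) := by
      ext x
      simp only [Finset.mem_sdiff, Finset.mem_insert]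
      by_cases hx : x = a
      · subst hx; simp [haS, hat]
      · simp [hx]
    rw [e1, rms_insert'] at ih'
    have hc : (S \ insert a t).card + (insert a t).card = S.card :=
      Finset.card_sdiff_add_card_eq_card htS
    have hci := Finset.card_insert_of_notMem hat
    have hY := rms_gc' (s := S \ insert a t) (m := r + t.card + 1) (by have := h.1; omega) h.2.1
      (fun L hL => h.2.2 L (Finset.mem_sdiff.mp hL).1)
    rw [hci, ← add_assoc]
    obtain ⟨hZ, aZ, eZ⟩ := h.Z haS
    obtain ⟨P, hP, hPa, hPm⟩ := mx_meet hZ.1 aZ (ht a (by simp)) (rm_ne ih')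
    refine mx_up hY.1.1 (h.2.2 a haS).1 ih' ⟨P, ?_, hPa, hPm⟩
    simp only [mem_rms, Finset.mem_erase, Finset.mem_sdiff, Finset.mem_insert] at hP ⊢
    exact ⟨hP.1, fun L hL => hP.2 L ⟨fun e => hL.2 (Or.inl e), hL.1⟩⟩

lemma miss_ex {n r : ℕ} {X : Finset Pt} {S : Finset (Set Pt)} (h : St n r X S)
    (hall : ∀ L, Mx n X L → L ∈ S) {m : Set Pt} (hm : Mx r (rms X S) m) : ∃ l ∈ S, ¬ Hit r X S m l := by
  by_contra hc
  push Not at hc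
  have := upAll h hm S subset_rfl hc
  rw [← h.1] at this
  have e : rms X (S \ S) = X := by ext A; simp
  rw [e] at this
  exact not_mem_S hm (hall m this)

lemma miss_one {n r : ℕ} {X : Finset Pt} {S : Finset (Set Pt)} (h : St (n + 1) r X S)
    {m l : Set Pt} (hm : Mx r (rms X S) m) (hl : l ∈ S) (hh : ∀ l' ∈ S, l' ≠ l → Hit r X S m l') :
    Mx n (rm X l) m := by
  have := upAll h hm (S.erase l) (Finset.erase_subset _ _) (fun x hx => hh x (Finset.mem_of_mem_erase hx)
    (Finset.ne_of_mem_erase hx))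
  have hc := Finset.card_erase_add_one hl
  have e1 : r + (S.erase l).card = n := by have := h.1; omega
  have e : rms X (S \ S.erase l) = rm X l := by
    ext A
    simp only [mem_rms, mem_rm, Finset.mem_sdiff, Finset.mem_erase]
    constructor
    · rintro ⟨h1, h2⟩; exact ⟨h1, h2 l (by tauto)⟩
    · rintro ⟨h1, h2⟩
      refine ⟨h1, fun L hL => ?_⟩
      have : L = l := by tauto
      subst this; exact h2
  rwa [e1, e] at this

lemma hit_or {n r : ℕ} {X : Finset Pt} {S : Finset (Set Pt)} (h : St n (r + 1) X S)
    {m m' l : Set Pt} (hm : Mx (r + 1) (rms X S) m) (hm' : Mx (r + 1) (rms X S) m') (hne : m ≠ m')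
    (hl : l ∈ S) : Hit (r + 1) X S m l ∨ Hit (r + 1) X S m' l := by
  obtain ⟨hZ, aZ, eZ⟩ := h.Z hl
  exact lemM hZ aZ (by rw [eZ]; exact hm) (by rw [eZ]; exact hm') hne

lemma f4a : ∀ i : Fin 4, ∃ j k l : Fin 4, j ≠ i ∧ k ≠ i ∧ l ≠ i ∧ j ≠ k ∧ j ≠ l ∧ k ≠ l := by decide
lemma f4b : ∀ i j : Fin 4, i ≠ j → ∃ k l : Fin 4, k ≠ i ∧ l ≠ i ∧ k ≠ j ∧ l ≠ j ∧ k ≠ l := by decide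

lemma baseA {X : Finset Pt} {S : Finset (Set Pt)} (h : St 6 2 X S) (m lam : Fin 4 → Set Pt)
    (hm : ∀ i, Mx 2 (rms X S) (m i)) (inj : ∀ i j, i ≠ j → m i ≠ m j) (hS : ∀ i, lam i ∈ S)
    (hmiss : ∀ i, ¬ Hit 2 X S (m i) (lam i)) : False := by
  have hit : ∀ i j, i ≠ j → Hit 2 X S (m i) (lam j) := fun i j hij =>
    (hit_or h (hm i) (hm j) (inj i j hij) (hS j)).resolve_right (hmiss j)
  have linj : ∀ i j, i ≠ j → lam i ≠ lam j := fun i j hij e => hmiss i (by rw [e]; exact hit i j hij)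
  have hB : ∀ i, ∃ B ∈ rms X (S.erase (lam i)), B ∈ lam i ∧ ∀ j, B ∉ m j := by
    intro i
    obtain ⟨hZ, aZ, eZ⟩ := h.Z (hS i)
    obtain ⟨j, k, l, hj, hk, hl, hjk, hjl, hkl⟩ := f4a i
    have nl : ∀ j, m j ≠ lam i := fun j => by
      have := hm j
      rw [← eZ] at this
      exact (rm_ne this).symm
    have h1 := hZ.rm (hit j i hj)
    have k1 := mx_rm hZ.1 (hit j i hj) (hit k i hk) (inj _ _ hjk)
    have l1 := mx_rm hZ.1 (hit j i hj) (hit l i hl) (inj _ _ hjl)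
    have a1 := mx_rm hZ.1 (hit j i hj) aZ (nl j)
    have h2 := h1.rm k1
    have l2 := mx_rm h1.1 k1 l1 (inj _ _ hkl)
    have a2 := mx_rm h1.1 k1 a1 (nl k)
    have a3 := mx_rm h2.1 l2 a2 (nl l)
    obtain ⟨B, hB⟩ := Finset.card_pos.mp (by rw [a3.2]; omega)
    simp only [mem_on, mem_rm] at hB
    refine ⟨B, hB.1.1.1.1, hB.2, fun q => ?_⟩
    have : q = i ∨ q = j ∨ q = k ∨ q = l := by omega
    rcases this with rfl | rfl | rfl | rfl
    · exact mx_miss hZ.1 aZ.1 (by rw [eZ]; exact hm q) (hmiss q) B hB.1.1.1.1 hB.2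
    · exact hB.1.1.1.2
    · exact hB.1.1.2
    · exact hB.1.2
  choose B BZ Bl Bm using hB
  refine caseA h.K m B hm inj Bm (fun i j hij e => ?_) (fun i j hij => ?_)
  · have := BZ j
    simp only [mem_rms, Finset.mem_erase] at this
    exact this.2 (lam i) ⟨linj i j hij, hS i⟩ (e ▸ Bl i)
  · obtain ⟨k, l, hki, hli, hkj, hlj, hkl⟩ := f4b i j hij
    obtain ⟨Y, hY, aY, bY, e1, e2, e3⟩ := h.Y (hS i) (hS j) (linj i j hij)
    have H1 : ∀ q, q ≠ i → Mx 3 (rm Y (lam j)) (m q) := fun q hq => by rw [e1]; exact hit q i hq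
    have H2 : ∀ q, q ≠ j → Mx 3 (rm Y (lam i)) (m q) := fun q hq => by rw [e2]; exact hit q j hq
    refine pairA hY aY bY (linj i j hij) (mk := m k) (ml := m l) (inj _ _ hij) (inj _ _ hki.symm)
      (inj _ _ hli.symm) (inj _ _ hkj.symm) (inj _ _ hlj.symm) (inj _ _ hkl) (H1 _ hki) (H1 _ hli)
      (H1 _ hij.symm) (H2 _ hkj) (H2 _ hlj) (H2 _ hij) (by rw [e3]; exact hm i) (by rw [e3]; exact hm j)
      (by rw [e1]; exact hmiss i) (by rw [e2]; exact hmiss j) ?_ ?_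
    · simp only [mem_rm (L := m j), mem_rm (L := m k), mem_rm (L := m l), e1]
      exact ⟨⟨⟨BZ i, Bm i k⟩, Bm i l⟩, Bm i j⟩
    · simp only [mem_rm (L := m i), mem_rm (L := m k), mem_rm (L := m l), e2]
      exact ⟨⟨⟨BZ j, Bm j k⟩, Bm j l⟩, Bm j i⟩

lemma baseB {X : Finset Pt} {S : Finset (Set Pt)} (h : St 6 2 X S) (hc : 4 ≤ S.card)
    (m lam : Fin 3 → Set Pt)
    (hm : ∀ i, Mx 2 (rms X S) (m i)) (inj : ∀ i j, i ≠ j → m i ≠ m j) (hS : ∀ i, lam i ∈ S)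
    (hmiss : ∀ i, ¬ Hit 2 X S (m i) (lam i)) (hall : ∀ s, Mx 2 (rms X S) s → ∃ i, s = m i) : False := by
  have hitg : ∀ i j l, i ≠ j → l ∈ S → ¬ Hit 2 X S (m j) l → Hit 2 X S (m i) l := fun i j l hij hl hn =>
    (hit_or h (hm i) (hm j) (inj i j hij) hl).resolve_right hn
  have hit : ∀ i j, i ≠ j → Hit 2 X S (m i) (lam j) := fun i j hij => hitg i j _ hij (hS j) (hmiss j)
  have linj : ∀ i j, i ≠ j → lam i ≠ lam j := fun i j hij e => hmiss i (by rw [e]; exact hit i j hij)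
  obtain ⟨w, Q, T⟩ := tri_mk h.K m hm inj hall
  obtain ⟨d, hd, hdl⟩ : ∃ d ∈ S, ∀ i, lam i ≠ d := by
    have : (Finset.univ.image lam).card < S.card := lt_of_le_of_lt Finset.card_image_le (by simp; omega)
    obtain ⟨d, h1, h2⟩ := Finset.exists_mem_notMem_of_card_lt_card this
    exact ⟨d, h1, fun i e => h2 (by simp [← e])⟩
  by_cases hdm : ∃ k, ¬ Hit 2 X S (m k) d
  · obtain ⟨k, hk⟩ := hdm
    obtain ⟨i, j, hik, hjk, hij⟩ := two3 k
    obtain ⟨O, hO, Oi, Ok⟩ := mx_meet h.K.1 (hm i) (hm k) (inj _ _ hik)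
    obtain ⟨hZ, aZ, eZ⟩ := h.Z (hS i)
    have nl : ∀ j, m j ≠ lam i := fun j => by
      have := hm j
      rw [← eZ] at this
      exact (rm_ne this).symm
    have aj := hit j i hij.symm
    have ak := hit k i hik.symm
    have waj : Mx 2 (rm (rms X (S.erase (lam i))) (m j)) (w j) := wh hZ aZ aj (nl j)
      (by rw [eZ]; exact hm i) (inj _ _ hij.symm) (hmiss i) (by rw [eZ]; exact T.W j) (T.wm _ _)
    have h1 := hZ.rm aj
    have hk0 := (mx_rm hZ.1 aj ak (inj _ _ hjk))
    obtain ⟨P, hP'⟩ := gc0 ((h1.rm waj).rm (mx_rm h1.1 waj hk0 (T.wm _ _))).1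
    have hP : P ∈ rm (rm (rm (rms X (S.erase (lam i))) (m j)) (w j)) (m k) := by rw [hP']; simp
    have key : ∀ c, c ∈ S → lam i ≠ c → ¬ Hit 2 X S (m k) c → ∃ g, Ln g ∧ O ∈ g ∧ P ∈ g ∧ P ≠ O ∧
        ∃ R ∈ rms X (S.erase c), R ∈ g ∧ R ∈ w i ∧ R ∈ c := by
      intro c hc hac hkc
      obtain ⟨Y, hY, aY, cY, e1, e2, e3⟩ := h.Y (hS i) hc hac
      have := pairB1 hY aY cY hac (m := m) (w := w) (Q := Q) (by rw [e3]; exact T) hij hik hjk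
        (by rw [e1]; exact aj) (by rw [e1]; exact ak) (by rw [e1]; exact hmiss i)
        (by rw [e2]; exact hitg i k c hik hc hkc) (by rw [e2]; exact hitg j k c hjk hc hkc)
        (by rw [e2]; exact hkc) (O := O) (P := P) (by rw [e3]; exact hO) Oi Ok (by rw [e1]; exact hP)
      rw [e2] at this
      exact this
    obtain ⟨g, hg, Og, Pg, hPO, R, hR, Rg, Rw, Rc⟩ := key (lam k) (hS k) (linj _ _ hik) (hmiss k)
    obtain ⟨g', hg', Og', Pg', -, R', hR', Rg', Rw', Rd⟩ := key d hd (hdl i) hk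
    have egg := line_eq hg hg' hPO Pg Og Pg' Og'
    subst egg
    have hRR : R ≠ R' := by
      rintro rfl
      simp only [mem_rms, Finset.mem_erase] at hR
      exact hR.2 d ⟨(hdl k).symm, hd⟩ Rd
    have e := line_eq hg (T.W i).1 hRR Rg Rg' Rw Rw'
    subst e
    have hOQ : O ≠ Q k := by
      rintro rfl
      exact T.Qn k i hik.symm Oi
    exact T.wm i k (line_eq hg (hm k).1 hOQ Og (T.Qw i k hik) Ok (T.Qm k))
  · push Not at hdm
    obtain ⟨hZ, dZ, eZ⟩ := h.Z hd
    have h1 := hZ.rm (hdm 0)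
    have h2 := mx_rm hZ.1 (hdm 0) (hdm 1) (inj 0 1 (by decide))
    have h3 := mx_rm h1.1 h2 (mx_rm hZ.1 (hdm 0) (hdm 2) (inj 0 2 (by decide))) (inj 1 2 (by decide))
    obtain ⟨B, hB'⟩ := gc0 ((h1.rm h2).rm h3).1
    have hB : B ∈ rm (rm (rm (rms X (S.erase d)) (m 0)) (m 1)) (m 2) := by rw [hB']; simp
    simp only [mem_rm] at hB
    have Bm : ∀ q, B ∉ m q := by
      intro q; fin_cases q
      · exact hB.1.1.2
      · exact hB.1.2
      · exact hB.2
    have key : ∀ i j k, i ≠ j → i ≠ k → j ≠ k → B ∈ d ∧ (B ∈ w j ∨ B ∈ w k) := by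
      intro i j k hij hik hjk
      obtain ⟨Y, hY, aY, cY, e1, e2, e3⟩ := h.Y (hS i) hd (hdl i)
      exact pairB2 hY aY cY (hdl i) (m := m) (w := w) (Q := Q) (by rw [e3]; exact T) hij hik hjk
        (by rw [e1]; exact hit j i hij.symm) (by rw [e1]; exact hit k i hik.symm)
        (by rw [e1]; exact hmiss i)
        (by rw [e2]; exact hdm i) (by rw [e2]; exact hdm j)
        (by rw [e2]; exact hdm k) (by rw [e2]; exact hB.1.1.1) Bm
    have k0 := key 0 1 2 (by decide) (by decide) (by decide)
    have k1 := key 1 0 2 (by decide) (by decide) (by decide)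
    have k2 := key 2 0 1 (by decide) (by decide) (by decide)
    have fin : ∀ i j, i ≠ j → B ∈ w i → B ∈ w j → False := by
      intro i j hij hi hj
      obtain ⟨k, hki, hkj⟩ := third3 i j hij
      have := pt_eq (T.W i).1 (T.W j).1 (T.ww i j hij) hi (T.Qw i k hki.symm) hj (T.Qw j k hkj.symm)
      have hq := T.QK k
      rw [← this] at hq
      simp only [mem_rms] at hq
      exact hq.2 d hd k0.1
    rcases k0.2 with a | a <;> rcases k1.2 with b | b <;> rcases k2.2 with c | c <;>
      first
      | exact fin 0 1 (by decide) ‹_› ‹_›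
      | exact fin 0 2 (by decide) ‹_› ‹_›
      | exact fin 1 2 (by decide) ‹_› ‹_›

lemma base6 {X : Finset Pt} (h : G 6 X) (hc : (ML 6 X).card = 4) : False := by
  have hS : St 6 2 X (ML 6 X) := ⟨by rw [hc], h, fun L hL => mem_ML.mp hL⟩
  set S := ML 6 X with hSd
  have hmiss : ∀ m, Mx 2 (rms X S) m → ∃ l ∈ S, ¬ Hit 2 X S m l := fun m hm =>
    miss_ex hS (fun L hL => mem_ML.mpr hL) hm
  by_cases h4 : 4 ≤ (ML 2 (rms X S)).card
  · obtain ⟨F, hF, hFc⟩ := Finset.exists_subset_card_eq h4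
    let e := (F.equivFinOfCardEq hFc).symm
    have hm : ∀ i, Mx 2 (rms X S) (e i : Set Pt) := fun i => mem_ML.mp (hF (e i).2)
    choose lam h1 h2 using fun i => hmiss _ (hm i)
    exact baseA hS (fun i => (e i : Set Pt)) lam hm
      (fun i j hij he => hij (e.injective (Subtype.ext he))) h1 h2
  · have hFc : (ML 2 (rms X S)).card = 3 := by
      have : 3 ≤ (ML 2 (rms X S)).card := three_max hS.K
      omega
    let e := ((ML 2 (rms X S)).equivFinOfCardEq hFc).symm
    have hm : ∀ i, Mx 2 (rms X S) (e i : Set Pt) := fun i => mem_ML.mp (e i).2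
    choose lam h1 h2 using fun i => hmiss _ (hm i)
    refine baseB hS (by omega) (fun i => (e i : Set Pt)) lam hm
      (fun i j hij he => hij (e.injective (Subtype.ext he))) h1 h2 (fun s hs => ?_)
    refine ⟨e.symm ⟨s, mem_ML.mpr hs⟩, ?_⟩
    simp

end


section
open Classical

lemma classif : ∀ (n : ℕ) (X : Finset Pt), G n X → 4 ≤ (ML n X).card → n ≤ (ML n X).card + 1 := by
  intro n
  induction n using Nat.strong_induction_on with
  | _ n IH =>
  intro X h h4
  by_contra hcon
  push Not at hcon
  obtain ⟨N, rfl⟩ : ∃ N, n = N + 2 := ⟨n - 2, by omega⟩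
  obtain ⟨r, hr⟩ : ∃ r, N + 2 = (r + 1 + 1) + (ML (N + 2) X).card :=
    ⟨N - (ML (N + 2) X).card, by omega⟩
  have hSt : St (N + 2) (r + 1 + 1) X (ML (N + 2) X) := ⟨hr, h, fun L hL => mem_ML.mp hL⟩
  set S := ML (N + 2) X with hSd
  have hmem : ∀ L, L ∈ S ↔ Mx (N + 2) X L := fun L => mem_ML
  have sub : ∀ l ∈ S, S.erase l ⊆ ML (N + 1) (rm X l) := by
    intro l hl m hm
    rw [mem_ML]
    exact mx_rm h.1 ((hmem l).1 hl) ((hmem m).1 (Finset.mem_of_mem_erase hm)) (Finset.ne_of_mem_erase hm).symm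
  have new : ∀ l ∈ S, ∀ e ∈ ML (N + 1) (rm X l), e ∉ S.erase l → e ∉ S := by
    intro l hl e he hn hS
    exact hn (Finset.mem_erase.mpr ⟨(rm_ne (mem_ML.mp he)).symm, hS⟩)
  have up : ∀ l ∈ S, (ML (N + 1) (rm X l)).card ≤ S.card := by
    intro l hl
    by_contra hc
    push Not at hc
    have hce := Finset.card_erase_add_one hl
    have hcs := Finset.card_sdiff_add_card_eq_card (sub l hl)
    obtain ⟨e, he, e', he', hee⟩ := Finset.one_lt_card.mp
      (by omega : 1 < (ML (N + 1) (rm X l) \ S.erase l).card)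
    rw [Finset.mem_sdiff] at he he'
    rcases lemM h ((hmem l).1 hl) (mem_ML.mp he.1) (mem_ML.mp he'.1) hee with h1 | h1
    · exact new l hl e he.1 he.2 ((hmem _).2 h1)
    · exact new l hl e' he'.1 he'.2 ((hmem _).2 h1)
  by_cases h5 : 5 ≤ S.card
  · have ex : ∀ l : S, ∃ e, Mx (N + 1) (rm X l) e ∧ e ∉ S := by
      rintro ⟨l, hl⟩
      have hce := Finset.card_erase_add_one hl
      have hle := Finset.card_le_card (sub l hl)
      have hI := IH (N + 1) (by omega) (rm X l) (h.rm ((hmem l).1 hl)) (by omega)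
      have := up l hl
      obtain ⟨e, he, hn⟩ := Finset.exists_mem_notMem_of_card_lt_card
        (s := S.erase l) (t := ML (N + 1) (rm X l)) (by omega)
      exact ⟨e, mem_ML.mp he, new l hl e he hn⟩
    choose e he hn using ex
    have hr0 : r = 0 := by
      obtain ⟨l, hl⟩ := Finset.card_pos.mp (by omega : 0 < S.card)
      have hce := Finset.card_erase_add_one hl
      have hle := Finset.card_le_card (sub l hl)
      have hI := IH (N + 1) (by omega) (rm X l) (h.rm ((hmem l).1 hl)) (by omega)
      have := up l hl
      omega
    subst hr0
    have einj : Function.Injective e := by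
      intro l l' hll
      by_contra hne
      have h2 := he l'
      rw [← hll] at h2
      exact hn l ((hmem _).2 (up2 h ((hmem _).1 l.2) ((hmem _).1 l'.2)
        (fun hh => hne (Subtype.ext hh)) (he l) h2))
    have eF : ∀ l, e l ∈ ML 2 (rms X S) := by
      intro l
      rw [mem_ML]
      have hce := Finset.card_erase_add_one l.2
      have hl := (hmem _).1 l.2
      have := (rms_gc' (s := S.erase l) (m := 2) (n := N + 1) (X := rm X l) (by omega) (h.rm hl)
        (fun L hL => mem_ML.mp (sub l l.2 hL))).2 (e l) (fun hh => hn l (Finset.mem_of_mem_erase hh)) (he l)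
      rwa [← rms_insert, Finset.insert_erase l.2] at this
    have c1 : (Finset.univ.image e).card = S.card := by
      rw [Finset.card_image_of_injective _ einj]; simp
    have c2 : Finset.univ.image e ⊆ ML 2 (rms X S) := by
      intro x hx
      obtain ⟨l, -, rfl⟩ := Finset.mem_image.mp hx
      exact eF l
    have c3 := Finset.card_le_card c2
    have c4 : (ML 2 (rms X S)).card ≤ 4 := mu_le hSt.K.1
    omega
  · have hS4 : S.card = 4 := by omega
    by_cases hr0 : r = 0
    · subst hr0
      obtain rfl : N = 4 := by omega
      exact base6 h hS4
    have two : ∀ m, Mx (r + 1 + 1) (rms X S) m → 2 ≤ (S.filter (fun l => ¬ Hit (r + 1 + 1) X S m l)).card := by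
      intro m hm
      by_contra hlt
      push Not at hlt
      obtain ⟨l, hl, hml⟩ := miss_ex hSt (fun L hL => (hmem L).2 hL) hm
      have hone := Finset.card_le_one.mp (by omega : (S.filter (fun l => ¬ Hit (r + 1 + 1) X S m l)).card ≤ 1)
      have hmx := miss_one hSt hm hl (fun l' hl' hne => by
        by_contra hh
        exact hne (hone l' (by simp [hl', hh]) l (by simp [hl, hml])))
      have hmS := not_mem_S hm
      have hce := Finset.card_erase_add_one hl
      have hi : insert m (S.erase l) ⊆ ML (N + 1) (rm X l) :=
        Finset.insert_subset (mem_ML.mpr hmx) (sub l hl)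
      have hic := Finset.card_le_card hi
      rw [Finset.card_insert_of_notMem (fun hh => hmS (Finset.mem_of_mem_erase hh))] at hic
      have hI := IH (N + 1) (by omega) (rm X l) (h.rm ((hmem l).1 hl)) (by omega)
      have := up l hl
      omega
    have disj : ∀ m m', Mx (r + 1 + 1) (rms X S) m → Mx (r + 1 + 1) (rms X S) m' → m ≠ m' →
        Disjoint (S.filter (fun l => ¬ Hit (r + 1 + 1) X S m l))
          (S.filter (fun l => ¬ Hit (r + 1 + 1) X S m' l)) := by
      intro m m' hm hm' hne
      rw [Finset.disjoint_left]
      intro l h1 h2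
      rw [Finset.mem_filter] at h1 h2
      rcases hit_or hSt hm hm' hne h1.1 with h3 | h3
      · exact h1.2 h3
      · exact h2.2 h3
    obtain ⟨a, b, c, ha, hb, hc, hab, hac, hbc⟩ := three_of (three_max hSt.K)
    rw [mem_ML] at ha hb hc
    have ta := two a ha
    have tb := two b hb
    have tc := two c hc
    have u1 := Finset.card_union_of_disjoint (disj a b ha hb hab)
    have u2 := Finset.card_union_of_disjoint
      (Finset.disjoint_union_left.mpr ⟨disj a c ha hc hac, disj b c hb hc hbc⟩)
    have u3 := Finset.card_le_card (Finset.union_subset (Finset.union_subset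
      (Finset.filter_subset (fun l => ¬ Hit (r + 1 + 1) X S a l) S)
      (Finset.filter_subset (fun l => ¬ Hit (r + 1 + 1) X S b l) S))
      (Finset.filter_subset (fun l => ¬ Hit (r + 1 + 1) X S c l) S))
    omega

end

lemma final (n k : ℕ) (hGM : ∀ m ≤ n, GM m) (hn : 5 ≤ n)
    (X : Finset Pt) (hX : IsGC n X)
    (l : Poly2) (hl : IsKNodeLine X l k)
    (hs : (2 * k : ℤ) - n - 1 = 2) (hmu : 3 < mu n X)
    (hempty : usesSet n X l = ∅) :
    ∀ lam : Poly2, IsMaximalLine n X lam →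
      ∃ A ∈ X, evalPt lam A = 0 ∧ evalPt l A = 0 := by
  intro lam hlam
  obtain ⟨N, rfl⟩ : ∃ N, n = N + 2 := ⟨n - 2, by omega⟩
  have h : G (N + 2) X := ⟨hX, hGM⟩
  by_contra hcon
  have hL := mx_of hlam
  have hne : zeroSet lam ≠ zeroSet l := by
    intro e
    obtain ⟨A, hA⟩ := Finset.card_pos.mp (by rw [hL.2]; omega : 0 < (on X (zeroSet lam)).card)
    rw [mem_on] at hA
    exact hcon ⟨A, hA.1, hA.2, mem_zs.mp (by rw [← e]; exact hA.2)⟩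
  have hc : (on (rm X (zeroSet lam)) (zeroSet l)).card = k := by
    rcases card_on_rm (X := X) hL.1 ⟨l, hl.1, rfl⟩ hne with ⟨h1, -⟩ | ⟨-, h1⟩
    · exact absurd h1 hcon
    · rw [← h1, ← nodesOn_eq]; exact hl.2
  rw [mu_eq] at hmu
  have h1 := classif _ X h hmu
  have h2 := mu_rm h hL
  have h3 := thmU (N + 1) _ (zeroSet l) (h.rm hL) (by omega) ⟨l, hl.1, rfl⟩ (by
    rw [hc]; push_cast at hs; omega)
  have h4 := uses_of_ne hl.1 (ne_lift hL.1 h3)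
  rw [hempty] at h4
  exact Finset.not_nonempty_empty h4

end GCL

/-- Assuming GM up to degree `n`, let `X` be a `GC_n` set with `n ≥ 5`,
`ℓ` a `k`-node line with `2k - n - 1 = 2` and `μ(X) > 3`, and suppose `X_ℓ = ∅`. Then
every maximal line of `X` intersects `ℓ` at a node of `X`. -/
theorem stmt_11 (n k : ℕ) (hGM : ∀ m ≤ n, GM m) (hn : 5 ≤ n)
    (X : Finset (ℝ × ℝ)) (hX : IsGC n X)
    (ℓ : Poly2) (hℓ : IsKNodeLine X ℓ k)
    (hσ : (2 * k : ℤ) - n - 1 = 2) (hμ : 3 < mu n X)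
    (hempty : usesSet n X ℓ = ∅) :
    ∀ lam : Poly2, IsMaximalLine n X lam →
      ∃ A ∈ X, evalPt lam A = 0 ∧ evalPt ℓ A = 0 := by
  exact GCL.final n k hGM hn X hX ℓ hℓ hσ hμ hempty
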